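/- arXiv:1006.3470 — 2 statements merged into one kernel-verified Lean document; each statement's English description precedes it below -/
import Mathlib

section
/- In the backward framework, for all 0 < t₀ ≤ t₁ ≤ T̄ the energy–flux identity holds: E(t₁) − E(t₀) = F(t₀, t₁). -/
open Real MeasureTheory Set Filter Topology

/-- Time derivative `u_t`. -/
noncomputable def ut (u : ℝ → ℝ → ℝ) (t r : ℝ) : ℝ := deriv (fun s => u s r) t

/-- Radial derivative `u_r`. -/
noncomputable def ur (u : ℝ → ℝ → ℝ) (t r : ℝ) : ℝ := deriv (fun s => u t s) r

/-- Second time derivative `u_tt`. -/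
noncomputable def utt (u : ℝ → ℝ → ℝ) (t r : ℝ) : ℝ := deriv (fun s => ut u s r) t

/-- Second radial derivative `u_rr`. -/
noncomputable def urr (u : ℝ → ℝ → ℝ) (t r : ℝ) : ℝ := deriv (fun s => ur u t s) r

/-- Null derivative `u₊ = u_t + u_r`. -/
noncomputable def uplus (u : ℝ → ℝ → ℝ) (t r : ℝ) : ℝ := ut u t r + ur u t r

/-- Null derivative `u₋ = u_t - u_r`. -/
noncomputable def uminus (u : ℝ → ℝ → ℝ) (t r : ℝ) : ℝ := ut u t r - ur u t r

/-- The Adkins–Nappi equivariant wave equation at the point `(t, r)`. -/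
def ANeq (u : ℝ → ℝ → ℝ) (t r : ℝ) : Prop :=
  utt u t r - urr u t r - (2 / r) * ur u t r + Real.sin (2 * u t r) / r ^ 2 +
      (u t r - Real.sin (u t r) * Real.cos (u t r)) * (1 - Real.cos (2 * u t r)) / r ^ 4 = 0

/-- The energy density `e(t,r)`. -/
noncomputable def eDens (u : ℝ → ℝ → ℝ) (t r : ℝ) : ℝ :=
  (1 / 2) * (ut u t r ^ 2 + ur u t r ^ 2) + Real.sin (u t r) ^ 2 / r ^ 2 +
    (u t r - Real.sin (u t r) * Real.cos (u t r)) ^ 2 / (2 * r ^ 4)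

/-- The backward domain `D(T̄)`. -/
def Dom (T : ℝ) : Set (ℝ × ℝ) :=
  {p : ℝ × ℝ | 0 < p.1 ∧ p.1 ≤ 2 * T ∧ 0 ≤ p.2 ∧ p.2 ≤ min (2 * T - p.1) p.1}

/-- The local energy `E(t) = ∫_0^t e(t,r) r² dr`. -/
noncomputable def locE (u : ℝ → ℝ → ℝ) (t : ℝ) : ℝ := ∫ r in (0 : ℝ)..t, eDens u t r * r ^ 2

/-- The flux `F(t₀, t₁)` through the light cone `t = r`. -/
noncomputable def flux (u : ℝ → ℝ → ℝ) (t₀ t₁ : ℝ) : ℝ :=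
  ∫ r in t₀..t₁,
    ((1 / 2) * uplus u r r ^ 2 + Real.sin (u r r) ^ 2 / r ^ 2 +
      (u r r - Real.sin (u r r) * Real.cos (u r r)) ^ 2 / (2 * r ^ 4)) * r ^ 2

/-- The backward framework: `u` is smooth on a neighborhood of `D(T̄)`, solves the
Adkins–Nappi equation on `D(T̄)` (for `r > 0`), and has finite energy `E(T̄)`. -/
def BackwardFramework (u : ℝ → ℝ → ℝ) (T : ℝ) : Prop :=
  0 < T ∧
  (∃ V : Set (ℝ × ℝ), IsOpen V ∧ Dom T ⊆ V ∧
    ContDiffOn ℝ (⊤ : ℕ∞) (fun p : ℝ × ℝ => u p.1 p.2) V) ∧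
  (∀ p ∈ Dom T, 0 < p.2 → ANeq u p.1 p.2) ∧
  IntegrableOn (fun r => eDens u T r * r ^ 2) (Set.Ioc 0 T)

section Calculus

variable {w : ℝ → ℝ → ℝ} {t r : ℝ}

lemma hasDerivAt_fst_of_hasFDerivAt {F : ℝ × ℝ → ℝ} {L : ℝ × ℝ →L[ℝ] ℝ}
    (h : HasFDerivAt F L (t, r)) : HasDerivAt (fun s => F (s, r)) (L (1, 0)) t :=
  h.comp_hasDerivAt t ((hasDerivAt_id t).prodMk (hasDerivAt_const t r))

lemma hasDerivAt_snd_of_hasFDerivAt {F : ℝ × ℝ → ℝ} {L : ℝ × ℝ →L[ℝ] ℝ}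
    (h : HasFDerivAt F L (t, r)) : HasDerivAt (fun s => F (t, s)) (L (0, 1)) r :=
  h.comp_hasDerivAt r ((hasDerivAt_const r t).prodMk (hasDerivAt_id r))

lemma ut_eq_fderiv (h : DifferentiableAt ℝ (fun p : ℝ × ℝ => w p.1 p.2) (t, r)) :
    ut w t r = fderiv ℝ (fun p : ℝ × ℝ => w p.1 p.2) (t, r) (1, 0) :=
  (hasDerivAt_fst_of_hasFDerivAt h.hasFDerivAt).deriv

lemma ur_eq_fderiv (h : DifferentiableAt ℝ (fun p : ℝ × ℝ => w p.1 p.2) (t, r)) :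
    ur w t r = fderiv ℝ (fun p : ℝ × ℝ => w p.1 p.2) (t, r) (0, 1) :=
  (hasDerivAt_snd_of_hasFDerivAt h.hasFDerivAt).deriv

lemma hasDerivAt_ut (h : DifferentiableAt ℝ (fun p : ℝ × ℝ => w p.1 p.2) (t, r)) :
    HasDerivAt (fun s => w s r) (ut w t r) t :=
  (hasDerivAt_fst_of_hasFDerivAt h.hasFDerivAt).differentiableAt.hasDerivAt

lemma hasDerivAt_ur (h : DifferentiableAt ℝ (fun p : ℝ × ℝ => w p.1 p.2) (t, r)) :
    HasDerivAt (fun s => w t s) (ur w t r) r :=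
  (hasDerivAt_snd_of_hasFDerivAt h.hasFDerivAt).differentiableAt.hasDerivAt

lemma ut_eventuallyEq {p : ℝ × ℝ} (h : ContDiffAt ℝ 1 (fun p : ℝ × ℝ => w p.1 p.2) p) :
    (fun q : ℝ × ℝ => ut w q.1 q.2) =ᶠ[𝓝 p]
      fun q => fderiv ℝ (fun p : ℝ × ℝ => w p.1 p.2) q (1, 0) :=
  (h.eventually (by simp)).mono fun _ hq => ut_eq_fderiv (hq.differentiableAt (by simp))

lemma ur_eventuallyEq {p : ℝ × ℝ} (h : ContDiffAt ℝ 1 (fun p : ℝ × ℝ => w p.1 p.2) p) :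
    (fun q : ℝ × ℝ => ur w q.1 q.2) =ᶠ[𝓝 p]
      fun q => fderiv ℝ (fun p : ℝ × ℝ => w p.1 p.2) q (0, 1) :=
  (h.eventually (by simp)).mono fun _ hq => ur_eq_fderiv (hq.differentiableAt (by simp))

lemma contDiffAt_ut {p : ℝ × ℝ} {m n : WithTop ℕ∞}
    (h : ContDiffAt ℝ n (fun p : ℝ × ℝ => w p.1 p.2) p) (hmn : m + 1 ≤ n) :
    ContDiffAt ℝ m (fun q : ℝ × ℝ => ut w q.1 q.2) p :=
  ((h.fderiv_right hmn).clm_apply contDiffAt_const).congr_of_eventuallyEq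
    (ut_eventuallyEq (h.of_le (le_add_self.trans hmn)))

lemma contDiffAt_ur {p : ℝ × ℝ} {m n : WithTop ℕ∞}
    (h : ContDiffAt ℝ n (fun p : ℝ × ℝ => w p.1 p.2) p) (hmn : m + 1 ≤ n) :
    ContDiffAt ℝ m (fun q : ℝ × ℝ => ur w q.1 q.2) p :=
  ((h.fderiv_right hmn).clm_apply contDiffAt_const).congr_of_eventuallyEq
    (ur_eventuallyEq (h.of_le (le_add_self.trans hmn)))

lemma differentiableAt_ut {p : ℝ × ℝ} (h : ContDiffAt ℝ 2 (fun p : ℝ × ℝ => w p.1 p.2) p) :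
    DifferentiableAt ℝ (fun q : ℝ × ℝ => ut w q.1 q.2) p :=
  (contDiffAt_ut (m := 1) h (by norm_num)).differentiableAt (by simp)

lemma differentiableAt_ur {p : ℝ × ℝ} (h : ContDiffAt ℝ 2 (fun p : ℝ × ℝ => w p.1 p.2) p) :
    DifferentiableAt ℝ (fun q : ℝ × ℝ => ur w q.1 q.2) p :=
  (contDiffAt_ur (m := 1) h (by norm_num)).differentiableAt (by simp)

/-- Equality of the mixed second derivatives. -/
lemma ut_ur_eq_ur_ut (h : ContDiffAt ℝ 2 (fun p : ℝ × ℝ => w p.1 p.2) (t, r)) :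
    ut (ur w) t r = ur (ut w) t r := by
  have h₁ : DifferentiableAt ℝ (fderiv ℝ (fun p : ℝ × ℝ => w p.1 p.2)) (t, r) :=
    (h.fderiv_right (m := 1) (by norm_num)).differentiableAt (by simp)
  rw [ut_eq_fderiv (differentiableAt_ur h), ur_eq_fderiv (differentiableAt_ut h),
    (ur_eventuallyEq (h.of_le (by norm_num))).fderiv_eq,
    (ut_eventuallyEq (h.of_le (by norm_num))).fderiv_eq,
    fderiv_clm_apply h₁ (differentiableAt_const _),
    fderiv_clm_apply h₁ (differentiableAt_const _)]
  simpa using h.isSymmSndFDerivAt (by simp) (1, 0) (0, 1)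

end Calculus

/-- The nonlinearity `x - sin x cos x`. -/
noncomputable def anPot (x : ℝ) : ℝ := x - Real.sin x * Real.cos x

lemma anPot_ne_zero {x : ℝ} (hx : x ≠ 0) : anPot x ≠ 0 := by
  intro h
  have h₁ : Real.sin (2 * x) = 2 * x := by
    rw [Real.sin_two_mul]; unfold anPot at h; linarith
  have h₂ := Real.abs_sin_lt_abs (x := 2 * x) (by simpa using hx)
  rw [h₁] at h₂
  exact lt_irrefl _ h₂

lemma hasDerivAt_anPot (x : ℝ) : HasDerivAt anPot (1 - Real.cos (2 * x)) x := by
  have h := (hasDerivAt_id x).sub ((Real.hasDerivAt_sin x).mul (Real.hasDerivAt_cos x))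
  refine h.congr_deriv ?_
  rw [Real.cos_two_mul']; ring

lemma continuous_anPot : Continuous anPot := by unfold anPot; fun_prop

lemma anPot_isLittleO : anPot =o[𝓝 0] fun x => x := by
  have h := (hasDerivAt_anPot 0).isLittleO
  change (fun x : ℝ => x - Real.sin x * Real.cos x) =o[𝓝 0] fun x => x
  simpa [anPot] using h

/-- The energy density multiplied by `r ^ 2`, in a form that is regular at `r = 0`. -/
noncomputable def energyWeight (u : ℝ → ℝ → ℝ) (t r : ℝ) : ℝ :=
  r ^ 2 * (1 / 2 * (ut u t r ^ 2 + ur u t r ^ 2)) + Real.sin (u t r) ^ 2 +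
    1 / 2 * (anPot (u t r) / r) ^ 2

/-- The radial momentum density multiplied by `r ^ 2`. -/
noncomputable def momentumWeight (u : ℝ → ℝ → ℝ) (t r : ℝ) : ℝ :=
  r ^ 2 * (ut u t r * ur u t r)

lemma eDens_mul_sq {u : ℝ → ℝ → ℝ} {t r : ℝ} (hr : r = 0 → u t r = 0) :
    eDens u t r * r ^ 2 = energyWeight u t r := by
  unfold eDens energyWeight anPot
  by_cases h : r = 0
  · subst h; simp [hr rfl]
  · field_simp

section Weights

variable {u : ℝ → ℝ → ℝ} {t r : ℝ}

lemma differentiableAt_momentumWeight {p : ℝ × ℝ}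
    (h : ContDiffAt ℝ 2 (fun p : ℝ × ℝ => u p.1 p.2) p) :
    DifferentiableAt ℝ (fun p : ℝ × ℝ => momentumWeight u p.1 p.2) p := by
  have h₁ := differentiableAt_ut h
  have h₂ := differentiableAt_ur h
  unfold momentumWeight
  fun_prop

lemma differentiableAt_energyWeight {p : ℝ × ℝ}
    (h : ContDiffAt ℝ 2 (fun p : ℝ × ℝ => u p.1 p.2) p) (hp : p.2 ≠ 0) :
    DifferentiableAt ℝ (fun p : ℝ × ℝ => energyWeight u p.1 p.2) p := by
  have h₀ : DifferentiableAt ℝ (fun p : ℝ × ℝ => u p.1 p.2) p := h.differentiableAt (by simp)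
  have h₁ := differentiableAt_ut h
  have h₂ := differentiableAt_ur h
  have h₃ : DifferentiableAt ℝ (fun p : ℝ × ℝ => anPot (u p.1 p.2)) p :=
    (hasDerivAt_anPot _).differentiableAt.comp p h₀
  unfold energyWeight
  fun_prop (disch := assumption)

/-- The local conservation law `∂ₜ(r² e) = ∂ᵣ(r² uₜ uᵣ)`. -/
lemma ut_energyWeight (h : ContDiffAt ℝ 2 (fun p : ℝ × ℝ => u p.1 p.2) (t, r)) (hr : r ≠ 0)
    (heq : ANeq u t r) : ut (energyWeight u) t r = ur (momentumWeight u) t r := by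
  have h₀ : DifferentiableAt ℝ (fun p : ℝ × ℝ => u p.1 p.2) (t, r) := h.differentiableAt (by simp)
  have hu := hasDerivAt_ut h₀
  have hut := hasDerivAt_ut (differentiableAt_ut h)
  have hur := hasDerivAt_ut (differentiableAt_ur h)
  have hE : HasDerivAt (fun s => energyWeight u s r) _ t :=
    ((((hut.pow 2).add (hur.pow 2)).const_mul (1 / 2)).const_mul (r ^ 2)).add
      (hu.sin.pow 2) |>.add
      (((((hasDerivAt_anPot _).comp t hu).div_const r).pow 2).const_mul (1 / 2))
  have hP : HasDerivAt (fun s => momentumWeight u t s) _ r :=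
    ((hasDerivAt_id r).pow 2).mul
      ((hasDerivAt_ur (differentiableAt_ut h)).mul (hasDerivAt_ur (differentiableAt_ur h)))
  have e₁ : ut (energyWeight u) t r = _ := hE.deriv
  have e₂ : ur (momentumWeight u) t r = _ := hP.deriv
  rw [e₁, e₂, ut_ur_eq_ur_ut h]
  have hpde : ut (ut u) t r = ur (ur u) t r + (2 / r) * ur u t r - Real.sin (2 * u t r) / r ^ 2 -
      anPot (u t r) * (1 - Real.cos (2 * u t r)) / r ^ 4 := by
    have : utt u t r - urr u t r - (2 / r) * ur u t r + Real.sin (2 * u t r) / r ^ 2 +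
      anPot (u t r) * (1 - Real.cos (2 * u t r)) / r ^ 4 = 0 := heq
    change utt u t r = urr u t r + _ - _ - _
    linarith
  rw [hpde, Real.sin_two_mul]
  simp
  field_simp
  ring

end Weights

section Axis

variable {u : ℝ → ℝ → ℝ} {t : ℝ}

lemma continuousAt_energyWeight_axis
    (h : ContDiffAt ℝ 2 (fun p : ℝ × ℝ => u p.1 p.2) (t, 0))
    (h₀ : ∀ᶠ s in 𝓝 t, u s 0 = 0) :
    ContinuousAt (fun p : ℝ × ℝ => energyWeight u p.1 p.2) (t, 0) := by
  have hu : ContinuousAt (fun p : ℝ × ℝ => u p.1 p.2) (t, 0) := h.continuousAt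
  have hut := (differentiableAt_ut h).continuousAt
  have hur := (differentiableAt_ur h).continuousAt
  have hO : (fun p : ℝ × ℝ => u p.1 p.2) =O[𝓝 (t, 0)] fun p => p.2 := by
    obtain ⟨K, S, hS, hK⟩ := (h.of_le (by norm_num) : ContDiffAt ℝ 1 _ _).exists_lipschitzOnWith
    have hproj : Tendsto (fun p : ℝ × ℝ => (p.1, (0 : ℝ))) (𝓝 (t, 0)) (𝓝 (t, 0)) :=
      Continuous.tendsto' (by fun_prop) _ _ rfl
    refine Asymptotics.IsBigO.of_bound K ?_
    filter_upwards [hS, hproj hS, continuousAt_fst.eventually h₀] with p hp hp' hp₀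
    have := hK.dist_le_mul p hp _ hp'
    simpa [dist_eq_norm, Prod.norm_def, hp₀] using this
  have hquot : ContinuousAt (fun p : ℝ × ℝ => anPot (u p.1 p.2) / p.2) (t, 0) := by
    have hu₀ : Tendsto (fun p : ℝ × ℝ => u p.1 p.2) (𝓝 (t, 0)) (𝓝 0) := by
      simpa [ContinuousAt, h₀.self_of_nhds] using hu
    have := ((anPot_isLittleO.comp_tendsto hu₀).trans_isBigO hO).tendsto_div_nhds_zero
    simpa [ContinuousAt] using this
  unfold energyWeight
  fun_prop

/-- Finite energy forces the solution to vanish at the origin. -/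
lemma eq_zero_of_integrableOn
    (ht : 0 < t) (h : ContinuousAt (fun p : ℝ × ℝ => u p.1 p.2) (t, 0))
    (hint : IntegrableOn (fun r => eDens u t r * r ^ 2) (Set.Ioc 0 t)) : u t 0 = 0 := by
  by_contra hne
  refine not_intervalIntegrable_of_sub_inv_isBigO_punctured (c := 0) ?_ ht.ne left_mem_uIcc
    ((intervalIntegrable_iff_integrableOn_Ioc_of_le ht.le).2 hint)
  have hc : ContinuousAt (fun r => anPot (u t r) ^ 2) 0 := by
    have h₁ : ContinuousAt (fun r => u t r) 0 :=
      ContinuousAt.comp (f := fun r : ℝ => (t, r)) h (by fun_prop)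
    exact (continuous_anPot.continuousAt.comp h₁).pow 2
  set δ := anPot (u t 0) ^ 2
  have hδ : 0 < δ := by
    have := anPot_ne_zero hne
    positivity
  refine Asymptotics.IsBigO.of_bound (4 / δ) ?_
  have h₁ : ∀ᶠ r in 𝓝 (0 : ℝ), δ / 2 < anPot (u t r) ^ 2 :=
    hc.eventually_const_lt (half_lt_self hδ)
  have h₂ : ∀ᶠ r in 𝓝 (0 : ℝ), |r| < 1 :=
    continuous_abs.continuousAt.eventually_lt_const (by simp)
  filter_upwards [nhdsWithin_le_nhds h₁, nhdsWithin_le_nhds h₂, self_mem_nhdsWithin]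
    with r hr₁ hr₂ hr₀
  have hr₀' : 0 < |r| := abs_pos.2 hr₀
  have hE : δ / (4 * |r| ^ 2) ≤ eDens u t r * r ^ 2 := by
    rw [eDens_mul_sq fun h => absurd h hr₀]
    have h₃ : δ / (4 * |r| ^ 2) ≤ 1 / 2 * (anPot (u t r) / r) ^ 2 := by
      rw [div_pow, sq_abs, ← sub_nonneg]
      have : 1 / 2 * (anPot (u t r) ^ 2 / r ^ 2) - δ / (4 * r ^ 2) =
          (anPot (u t r) ^ 2 - δ / 2) / (2 * r ^ 2) := by
        have : r ≠ 0 := hr₀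
        field_simp
        ring
      rw [this]
      have := sub_pos.2 hr₁
      positivity
    unfold energyWeight
    have : 0 ≤ r ^ 2 * (1 / 2 * (ut u t r ^ 2 + ur u t r ^ 2)) + Real.sin (u t r) ^ 2 := by
      positivity
    linarith
  calc ‖(r - 0)⁻¹‖ = 1 / |r| := by simp
    _ ≤ 1 / |r| ^ 2 := by
      refine one_div_le_one_div_of_le (by positivity) ?_
      nlinarith
    _ = 4 / δ * (δ / (4 * |r| ^ 2)) := by field_simp
    _ ≤ 4 / δ * ‖eDens u t r * r ^ 2‖ := by
      gcongr
      exact hE.trans (le_abs_self _)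

/-- The equation forces `sin u = 0` on the axis. -/
lemma sin_eq_zero_axis (h : ContDiffAt ℝ 2 (fun p : ℝ × ℝ => u p.1 p.2) (t, 0))
    (heq : ∀ᶠ r in 𝓝[>] 0, ANeq u t r) : Real.sin (u t 0) = 0 := by
  have hline : ∀ {F : ℝ × ℝ → ℝ}, ContinuousAt F (t, 0) → ContinuousAt (fun r => F (t, r)) 0 :=
    fun hF => ContinuousAt.comp (f := fun r : ℝ => (t, r)) hF (by fun_prop)
  have hu : ContinuousAt (fun r => u t r) 0 := hline h.continuousAt
  have hur : ContinuousAt (fun r => ur u t r) 0 := hline (differentiableAt_ur h).continuousAt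
  have hutt : ContinuousAt (fun r => utt u t r) 0 :=
    hline (contDiffAt_ut (m := 0) (contDiffAt_ut (m := 1) h (by norm_num)) (by simp)).continuousAt
  have hurr : ContinuousAt (fun r => urr u t r) 0 :=
    hline (contDiffAt_ur (m := 0) (contDiffAt_ur (m := 1) h (by norm_num)) (by simp)).continuousAt
  have hpot : ContinuousAt (fun r => anPot (u t r)) 0 := continuous_anPot.continuousAt.comp hu
  have hcont : ContinuousAt (fun r => r ^ 4 * utt u t r - r ^ 4 * urr u t r
      - 2 * r ^ 3 * ur u t r + r ^ 2 * Real.sin (2 * u t r)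
      + anPot (u t r) * (1 - Real.cos (2 * u t r))) 0 := by
    fun_prop
  have hzero : ∀ᶠ r in 𝓝[>] (0 : ℝ), r ^ 4 * utt u t r - r ^ 4 * urr u t r
      - 2 * r ^ 3 * ur u t r + r ^ 2 * Real.sin (2 * u t r)
      + anPot (u t r) * (1 - Real.cos (2 * u t r)) = 0 := by
    filter_upwards [heq, self_mem_nhdsWithin] with r hr hr₀
    have hr₀' : r ≠ 0 := ne_of_gt hr₀
    unfold ANeq at hr
    rw [← mul_zero (r ^ 4), ← hr]
    unfold anPot
    field_simp
  have hlim := tendsto_nhds_unique (hcont.mono_left nhdsWithin_le_nhds)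
    (tendsto_const_nhds.congr' (hzero.mono fun _ hr => hr.symm))
  have hprod : anPot (u t 0) * (1 - Real.cos (2 * u t 0)) = 0 := by simpa using hlim
  rcases mul_eq_zero.1 hprod with h₀ | h₀
  · rw [not_imp_comm.1 anPot_ne_zero (not_ne_iff.2 h₀), Real.sin_zero]
  · rw [Real.cos_two_mul'] at h₀
    have := Real.sin_sq_add_cos_sq (u t 0)
    exact pow_eq_zero_iff two_ne_zero |>.1 (by linarith)

end Axis

/-- A continuous function on an interval whose sine vanishes is zero if it is zero somewhere. -/
lemma eq_zero_of_sin_eq_zero {f : ℝ → ℝ} {a b : ℝ} (hf : ContinuousOn f (uIcc a b))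
    (hsin : ∀ x ∈ uIcc a b, Real.sin (f x) = 0) (ha : f a = 0) : f b = 0 := by
  have key : ∀ y ∈ uIcc 0 (f b), Real.sin y = 0 := by
    intro y hy
    obtain ⟨x, hx, rfl⟩ := intermediate_value_uIcc hf (ha ▸ hy)
    exact hsin x hx
  rcases lt_trichotomy (f b) 0 with h | h | h
  · have h₁ : Real.sin (max (f b) (-1)) < 0 := by
      refine Real.sin_neg_of_neg_of_neg_pi_lt (by simp [h]) ?_
      exact lt_of_lt_of_le (by linarith [Real.pi_gt_three]) (le_max_right _ _)
    refine absurd (key _ ?_) h₁.ne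
    rw [uIcc_of_ge h.le]
    exact ⟨le_max_left _ _, max_le h.le (by norm_num)⟩
  · exact h
  · have h₁ : 0 < Real.sin (min (f b) 1) := by
      refine Real.sin_pos_of_pos_of_lt_pi (by simp [h]) ?_
      exact (min_le_right _ _).trans_lt (by linarith [Real.pi_gt_three])
    refine absurd (key _ ?_) h₁.ne'
    rw [uIcc_of_le h.le]
    exact ⟨le_min h.le zero_le_one, min_le_left _ _⟩

/-- Divergence-free fields on a rectangle have zero net flux through its boundary. -/
lemma boundary_integral_eq_zero {f g : ℝ × ℝ → ℝ} {a₁ b₁ a₂ b₂ : ℝ} (h₁ : a₁ ≤ b₁) (h₂ : a₂ ≤ b₂)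
    (hf : ContinuousOn f (Icc a₁ b₁ ×ˢ Icc a₂ b₂)) (hg : ContinuousOn g (Icc a₁ b₁ ×ˢ Icc a₂ b₂))
    (hdf : ∀ p ∈ Ioo a₁ b₁ ×ˢ Ioo a₂ b₂, DifferentiableAt ℝ f p)
    (hdg : ∀ p ∈ Ioo a₁ b₁ ×ˢ Ioo a₂ b₂, DifferentiableAt ℝ g p)
    (hdiv : ∀ p ∈ Ioo a₁ b₁ ×ˢ Ioo a₂ b₂, fderiv ℝ f p (1, 0) + fderiv ℝ g p (0, 1) = 0) :
    (((∫ x in a₁..b₁, g (x, b₂)) - ∫ x in a₁..b₁, g (x, a₂)) + ∫ y in a₂..b₂, f (b₁, y)) -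
      ∫ y in a₂..b₂, f (a₁, y) = 0 := by
  set R := Ioo a₁ b₁ ×ˢ Ioo a₂ b₂
  have hzero : ∀ p, R.indicator (fderiv ℝ f) p (1, 0) + R.indicator (fderiv ℝ g) p (0, 1) = 0 := by
    intro p
    by_cases hp : p ∈ R
    · simpa [hp] using hdiv p hp
    · simp [hp]
  have key := integral2_divergence_prod_of_hasFDerivAt_off_countable f g
    (R.indicator (fderiv ℝ f)) (R.indicator (fderiv ℝ g)) a₁ a₂ b₁ b₂ ∅ countable_empty
    (by rwa [uIcc_of_le h₁, uIcc_of_le h₂]) (by rwa [uIcc_of_le h₁, uIcc_of_le h₂])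
    (by
      rw [min_eq_left h₁, min_eq_left h₂, max_eq_right h₁, max_eq_right h₂, sdiff_empty]
      intro p hp
      rw [indicator_of_mem hp]
      exact (hdf p hp).hasFDerivAt)
    (by
      rw [min_eq_left h₁, min_eq_left h₂, max_eq_right h₁, max_eq_right h₂, sdiff_empty]
      intro p hp
      rw [indicator_of_mem hp]
      exact (hdg p hp).hasFDerivAt)
    (by simp [hzero])
  rw [← key]
  simp [hzero]

/-- Integrated form of the conservation law `∂ₜ e = ∂ᵣ m` on a truncated light cone. -/
lemma integral_sub_integral_eq_of_ut_eq_ur {e m : ℝ → ℝ → ℝ} {t₀ t₁ : ℝ} (h₀ : 0 < t₀)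
    (h₀₁ : t₀ ≤ t₁)
    (he : ∀ t ∈ Icc t₀ t₁, ∀ r ∈ Icc 0 t, ContinuousAt (fun p : ℝ × ℝ => e p.1 p.2) (t, r))
    (hm : ∀ t ∈ Icc t₀ t₁, ∀ r ∈ Icc 0 t, ContinuousAt (fun p : ℝ × ℝ => m p.1 p.2) (t, r))
    (hde : ∀ t ∈ Ioo t₀ t₁, ∀ r ∈ Ioo 0 t,
      DifferentiableAt ℝ (fun p : ℝ × ℝ => e p.1 p.2) (t, r))
    (hdm : ∀ t ∈ Ioo t₀ t₁, ∀ r ∈ Ioo 0 t,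
      DifferentiableAt ℝ (fun p : ℝ × ℝ => m p.1 p.2) (t, r))
    (hlaw : ∀ t ∈ Ioo t₀ t₁, ∀ r ∈ Ioo 0 t, ut e t r = ur m t r)
    (hm₀ : ∀ t, m t 0 = 0) :
    (∫ r in (0 : ℝ)..t₁, e t₁ r) - ∫ r in (0 : ℝ)..t₀, e t₀ r =
      ∫ r in t₀..t₁, (e r r + m r r) := by
  have hmaps : ∀ p ∈ Icc t₀ t₁ ×ˢ Icc (0 : ℝ) 1, p.1 * p.2 ∈ Icc 0 p.1 := by
    rintro ⟨t, s⟩ ⟨ht, hs⟩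
    have ht₀ : 0 ≤ t := h₀.le.trans ht.1
    exact ⟨mul_nonneg ht₀ hs.1, mul_le_of_le_one_right ht₀ hs.2⟩
  have hmaps' : ∀ p ∈ Ioo t₀ t₁ ×ˢ Ioo (0 : ℝ) 1, p.1 * p.2 ∈ Ioo 0 p.1 := by
    rintro ⟨t, s⟩ ⟨ht, hs⟩
    have ht₀ : 0 < t := h₀.trans ht.1
    exact ⟨mul_pos ht₀ hs.1, mul_lt_of_lt_one_right ht₀ hs.2⟩
  have hce : ContinuousOn (fun p : ℝ × ℝ => e p.1 (p.1 * p.2)) (Icc t₀ t₁ ×ˢ Icc 0 1) :=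
    fun p hp => (ContinuousAt.comp (f := fun p : ℝ × ℝ => (p.1, p.1 * p.2))
      (he p.1 hp.1 _ (hmaps p hp)) (by fun_prop)).continuousWithinAt
  have hcm : ContinuousOn (fun p : ℝ × ℝ => m p.1 (p.1 * p.2)) (Icc t₀ t₁ ×ˢ Icc 0 1) :=
    fun p hp => (ContinuousAt.comp (f := fun p : ℝ × ℝ => (p.1, p.1 * p.2))
      (hm p.1 hp.1 _ (hmaps p hp)) (by fun_prop)).continuousWithinAt
  have hde' : ∀ p ∈ Ioo t₀ t₁ ×ˢ Ioo (0 : ℝ) 1,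
      DifferentiableAt ℝ (fun p : ℝ × ℝ => e p.1 (p.1 * p.2)) p :=
    fun p hp => DifferentiableAt.comp (f := fun p : ℝ × ℝ => (p.1, p.1 * p.2)) p
      (hde p.1 hp.1 _ (hmaps' p hp)) (by fun_prop)
  have hdm' : ∀ p ∈ Ioo t₀ t₁ ×ˢ Ioo (0 : ℝ) 1,
      DifferentiableAt ℝ (fun p : ℝ × ℝ => m p.1 (p.1 * p.2)) p :=
    fun p hp => DifferentiableAt.comp (f := fun p : ℝ × ℝ => (p.1, p.1 * p.2)) p
      (hdm p.1 hp.1 _ (hmaps' p hp)) (by fun_prop)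
  have hdf : ∀ p ∈ Ioo t₀ t₁ ×ˢ Ioo (0 : ℝ) 1,
      DifferentiableAt ℝ (fun p : ℝ × ℝ => p.1 * e p.1 (p.1 * p.2)) p :=
    fun p hp => differentiableAt_fst.mul (hde' p hp)
  have hdg : ∀ p ∈ Ioo t₀ t₁ ×ˢ Ioo (0 : ℝ) 1, DifferentiableAt ℝ
      (fun p : ℝ × ℝ => -(p.2 * e p.1 (p.1 * p.2) + m p.1 (p.1 * p.2))) p :=
    fun p hp => ((differentiableAt_snd.mul (hde' p hp)).add (hdm' p hp)).neg
  have key := boundary_integral_eq_zero (f := fun p : ℝ × ℝ => p.1 * e p.1 (p.1 * p.2))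
    (g := fun p : ℝ × ℝ => -(p.2 * e p.1 (p.1 * p.2) + m p.1 (p.1 * p.2)))
    h₀₁ (zero_le_one' ℝ) (continuousOn_fst.mul hce)
    ((continuousOn_snd.mul hce).add hcm).neg hdf hdg (by
      rintro ⟨t, s⟩ hp
      have hE := (hde t hp.1 _ (hmaps' _ hp)).hasFDerivAt
      have hM := (hdm t hp.1 _ (hmaps' _ hp)).hasFDerivAt
      have hL := hlaw t hp.1 _ (hmaps' _ hp)
      rw [ut_eq_fderiv hE.differentiableAt, ur_eq_fderiv hM.differentiableAt] at hL
      have h₁ := (hasDerivAt_fst_of_hasFDerivAt (hdf _ hp).hasFDerivAt).unique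
        ((hasDerivAt_id t).mul (HasFDerivAt.comp_hasDerivAt (f := fun x : ℝ => (x, x * s)) t hE
          ((hasDerivAt_id t).prodMk ((hasDerivAt_id t).mul_const s))))
      have hsnd := (hasDerivAt_const s t).prodMk ((hasDerivAt_id s).const_mul t)
      have h₂ := (hasDerivAt_snd_of_hasFDerivAt (hdg _ hp).hasFDerivAt).unique
        (((hasDerivAt_id s).mul
          (HasFDerivAt.comp_hasDerivAt (f := fun x : ℝ => (t, t * x)) s hE hsnd)).add
          (HasFDerivAt.comp_hasDerivAt (f := fun x : ℝ => (t, t * x)) s hM hsnd)).neg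
      rw [h₁, h₂]
      have v₁ : ((1 : ℝ), 1 * s) = (1, 0) + s • (0, 1) := by simp
      have v₂ : ((0 : ℝ), t * 1) = t • (0, 1) := by simp
      simp only [v₁, v₂, map_add, map_smul, hL, smul_eq_mul, id, Function.comp_apply]
      ring)
  have hscale : ∀ t, ∫ s in (0 : ℝ)..1, t * e t (t * s) = ∫ r in (0 : ℝ)..t, e t r := by
    intro t
    rw [intervalIntegral.integral_const_mul, intervalIntegral.mul_integral_comp_mul_left]
    simp
  simp only [hscale, mul_one, mul_zero, one_mul, zero_mul, hm₀, add_zero, neg_zero,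
    intervalIntegral.integral_neg, intervalIntegral.integral_zero, sub_zero] at key
  linarith

/-- The energy–flux identity in the backward framework:
`E(t₁) - E(t₀) = F(t₀, t₁)` for `0 < t₀ ≤ t₁ ≤ T̄`. -/
theorem energy_flux_identity (u : ℝ → ℝ → ℝ) (Tbar : ℝ)
    (h : BackwardFramework u Tbar) :
    ∀ t₀ t₁ : ℝ, 0 < t₀ → t₀ ≤ t₁ → t₁ ≤ Tbar →
      locE u t₁ - locE u t₀ = flux u t₀ t₁ := by
  intro t₀ t₁ h₀ h₀₁ h₁
  obtain ⟨hT, ⟨V, hV, hDV, hu⟩, heq, hint⟩ := h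
  have hC : ∀ p ∈ Dom Tbar, ContDiffAt ℝ 2 (fun p : ℝ × ℝ => u p.1 p.2) p := fun p hp =>
    (hu.contDiffAt (hV.mem_nhds (hDV hp))).of_le ENat.LEInfty.out
  have haxis : ∀ t ∈ Ioo 0 (2 * Tbar), (t, (0 : ℝ)) ∈ Dom Tbar := fun t ht =>
    ⟨ht.1, ht.2.le, le_rfl, le_min (sub_nonneg.2 ht.2.le) ht.1.le⟩
  have hcone : ∀ t ∈ Icc t₀ t₁, ∀ r ∈ Icc 0 t, (t, r) ∈ Dom Tbar := fun t ht r hr =>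
    ⟨h₀.trans_le ht.1, by linarith [ht.2], hr.1, le_min (by linarith [ht.2, hr.2]) hr.2⟩
  have hsin : ∀ t ∈ Ioo 0 (2 * Tbar), Real.sin (u t 0) = 0 := by
    intro t ht
    refine sin_eq_zero_axis (hC _ (haxis t ht)) ?_
    have hpos : 0 < min (2 * Tbar - t) t := lt_min (sub_pos.2 ht.2) ht.1
    filter_upwards [Ioo_mem_nhdsGT hpos] with r hr
    exact heq (t, r) ⟨ht.1, ht.2.le, hr.1.le, hr.2.le⟩ hr.1
  have hT' : Tbar ∈ Ioo 0 (2 * Tbar) := ⟨hT, by linarith⟩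
  have hzero : ∀ t ∈ Ioo 0 (2 * Tbar), u t 0 = 0 := by
    intro t ht
    have hsub : uIcc Tbar t ⊆ Ioo 0 (2 * Tbar) := ordConnected_Ioo.uIcc_subset hT' ht
    refine eq_zero_of_sin_eq_zero (f := fun s => u s 0) (a := Tbar) (fun s hs => ?_)
      (fun s hs => hsin s (hsub hs))
      (eq_zero_of_integrableOn hT (hC _ (haxis _ hT')).continuousAt hint)
    exact (ContinuousAt.comp (f := fun s : ℝ => (s, (0 : ℝ)))
      (hC _ (haxis s (hsub hs))).continuousAt (by fun_prop)).continuousWithinAt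
  have hmem : ∀ t ∈ Icc t₀ t₁, t ∈ Ioo 0 (2 * Tbar) := fun t ht =>
    ⟨h₀.trans_le ht.1, by linarith [ht.2]⟩
  have hlocE : ∀ t ∈ Icc t₀ t₁, locE u t = ∫ r in (0 : ℝ)..t, energyWeight u t r := by
    intro t ht
    refine intervalIntegral.integral_congr fun r _ => eDens_mul_sq ?_
    rintro rfl
    exact hzero t (hmem t ht)
  have hflux : flux u t₀ t₁ = ∫ r in t₀..t₁, (energyWeight u r r + momentumWeight u r r) := by
    refine intervalIntegral.integral_congr fun r hr => ?_
    rw [uIcc_of_le h₀₁] at hr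
    have hr₀ : r ≠ 0 := (h₀.trans_le hr.1).ne'
    simp only [energyWeight, momentumWeight, anPot, uplus]
    field_simp
    ring
  rw [hlocE t₁ ⟨h₀₁, le_rfl⟩, hlocE t₀ ⟨le_rfl, h₀₁⟩, hflux]
  refine integral_sub_integral_eq_of_ut_eq_ur h₀ h₀₁ ?_ ?_ ?_ ?_ ?_ ?_
  · intro t ht r hr
    rcases hr.1.eq_or_lt with rfl | hr₀
    · exact continuousAt_energyWeight_axis (hC _ (hcone t ht _ hr))
        (eventually_of_mem (Ioo_mem_nhds (hmem t ht).1 (hmem t ht).2) hzero)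
    · exact (differentiableAt_energyWeight (hC _ (hcone t ht r hr)) hr₀.ne').continuousAt
  · exact fun t ht r hr => (differentiableAt_momentumWeight (hC _ (hcone t ht r hr))).continuousAt
  · exact fun t ht r hr => differentiableAt_energyWeight
      (hC _ (hcone t (Ioo_subset_Icc_self ht) r (Ioo_subset_Icc_self hr))) hr.1.ne'
  · exact fun t ht r hr => differentiableAt_momentumWeight
      (hC _ (hcone t (Ioo_subset_Icc_self ht) r (Ioo_subset_Icc_self hr)))
  · intro t ht r hr
    have hD := hcone t (Ioo_subset_Icc_self ht) r (Ioo_subset_Icc_self hr)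
    exact ut_energyWeight (hC _ hD) hr.1.ne' (heq _ hD hr.1)
  · intro t
    simp [momentumWeight]
end

section
/- In the backward framework, there exists a sequence (sₙ) of positive reals with sₙ → 0 such that lim_{n→∞} ∫_0^{sₙ} [(1 − r/(2sₙ − r))·u₋(2sₙ − r, r)² + (u(2sₙ − r, r) − sin u(2sₙ − r, r)·cos u(2sₙ − r, r))²/r⁴] r² dr = 0. -/
open Real MeasureTheory Set Filter Topology

/-- The part of the forward cone `0 ≤ r ≤ t` lying below the backward cone `t + r = 2S`. -/
def coneRegion (S : ℝ) : Set (ℝ × ℝ) :=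
  {z | 0 < z.1 ∧ 0 ≤ z.2 ∧ z.2 ≤ z.1 ∧ z.1 + z.2 ≤ 2 * S}

/-- Integral of `g` along the backward cone `t + r = 2s`, `0 ≤ r ≤ s`. -/
noncomputable def coneInt (g : ℝ × ℝ → ℝ) (s : ℝ) : ℝ := ∫ r in (0 : ℝ)..s, g (2 * s - r, r)

lemma coneInt_eq_rescaled (g : ℝ × ℝ → ℝ) (s : ℝ) :
    coneInt g s = s * ∫ x in (0 : ℝ)..1, g (2 * s - s * x, s * x) := by
  have := intervalIntegral.mul_integral_comp_mul_left (a := 0) (b := 1)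
    (f := fun r => g (2 * s - r, r)) s
  rw [this]
  simp [coneInt]

lemma rescaled_mem_coneRegion {S s x : ℝ} (hs : 0 < s) (hS : s ≤ S) (h0 : 0 ≤ x) (h1 : x ≤ 1) :
    (2 * s - s * x, s * x) ∈ coneRegion S := by
  refine ⟨?_, ?_, ?_, ?_⟩ <;> simp only <;> nlinarith [mul_nonneg hs.le h0]

/-- Integrated form of `∂ₜ A - ∂ᵣ B = b` between two backward cones. -/
lemma coneInt_sub_coneInt {A B b : ℝ × ℝ → ℝ} {S s₀ s₁ : ℝ}
    (hA : ContinuousOn A (coneRegion S)) (hB : ContinuousOn B (coneRegion S))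
    (hb : ContinuousOn b (coneRegion S))
    (hdA : ∀ z ∈ coneRegion S, 0 < z.2 → DifferentiableAt ℝ A z)
    (hdB : ∀ z ∈ coneRegion S, 0 < z.2 → DifferentiableAt ℝ B z)
    (hdiv : ∀ z ∈ coneRegion S, 0 < z.2 → ∃ a c, HasDerivAt (fun t => A (t, z.2)) a z.1 ∧
      HasDerivAt (fun r => B (z.1, r)) c z.2 ∧ a - c = b z)
    (hB0 : ∀ t, B (t, 0) = 0) (h0 : 0 < s₀) (h01 : s₀ ≤ s₁) (h1 : s₁ ≤ S) :
    coneInt (fun z => A z - B z) s₁ - coneInt (fun z => A z - B z) s₀ =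
      (∫ s in s₀..s₁, (A (s, s) + B (s, s))) + ∫ s in s₀..s₁, 2 * coneInt b s := by
  set R : Set (ℝ × ℝ) := uIcc s₀ s₁ ×ˢ uIcc (0 : ℝ) 1 with hR
  set φ : ℝ × ℝ → ℝ × ℝ := fun y => (2 * y.1 - y.1 * y.2, y.1 * y.2) with hφ
  have hφc : Continuous φ := by fun_prop
  have hφm : MapsTo φ R (coneRegion S) := by
    rintro ⟨s, x⟩ ⟨hs, hx⟩
    rw [uIcc_of_le h01] at hs
    rw [uIcc_of_le zero_le_one] at hx
    exact rescaled_mem_coneRegion (h0.trans_le hs.1) (hs.2.trans h1) hx.1 hx.2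
  set F : ℝ × ℝ → ℝ := fun y => y.1 * (A (φ y) - B (φ y)) with hF
  set G : ℝ × ℝ → ℝ := fun y => -(y.2 * A (φ y) + (2 - y.2) * B (φ y)) with hG
  have hAc : ContinuousOn (fun y => A (φ y)) R := hA.comp hφc.continuousOn hφm
  have hBc : ContinuousOn (fun y => B (φ y)) R := hB.comp hφc.continuousOn hφm
  have hbc : ContinuousOn (fun y => b (φ y)) R := hb.comp hφc.continuousOn hφm
  have hFc : ContinuousOn F R := continuousOn_fst.mul (hAc.sub hBc)
  have hGc : ContinuousOn G R :=
    ((continuousOn_snd.mul hAc).add ((continuousOn_const.sub continuousOn_snd).mul hBc)).neg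
  set I : Set (ℝ × ℝ) := Ioo s₀ s₁ ×ˢ Ioo (0 : ℝ) 1 with hI
  have hdiff : ∀ y ∈ I, DifferentiableAt ℝ F y ∧ DifferentiableAt ℝ G y ∧
      fderiv ℝ F y (1, 0) + fderiv ℝ G y (0, 1) = 2 * (y.1 * b (φ y)) := by
    rintro ⟨s, x⟩ ⟨⟨hs0, hs1⟩, hx0, hx1⟩
    simp only at hs0 hs1 hx0 hx1
    have hs : 0 < s := h0.trans hs0
    have hm : φ (s, x) ∈ coneRegion S :=
      rescaled_mem_coneRegion hs (hs1.le.trans h1) hx0.le hx1.le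
    have hp : 0 < (φ (s, x)).2 := mul_pos hs hx0
    have dA := hdA _ hm hp
    have dB := hdB _ hm hp
    obtain ⟨a, c, ha, hc, hac⟩ := hdiv _ hm hp
    set z := φ (s, x) with hz
    have ha' : fderiv ℝ A z (1, 0) = a := by
      have h1 : HasDerivAt (fun t : ℝ => ((t, z.2) : ℝ × ℝ)) (1, 0) z.1 :=
        (hasDerivAt_id _).prodMk (hasDerivAt_const _ _)
      exact (dA.hasFDerivAt.comp_hasDerivAt z.1 h1).unique ha
    have hc' : fderiv ℝ B z (0, 1) = c := by
      have h1 : HasDerivAt (fun t : ℝ => ((z.1, t) : ℝ × ℝ)) (0, 1) z.2 :=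
        (hasDerivAt_const _ _).prodMk (hasDerivAt_id _)
      exact (dB.hasFDerivAt.comp_hasDerivAt z.2 h1).unique hc
    have hφd : DifferentiableAt ℝ φ (s, x) := by fun_prop
    have dAφ : DifferentiableAt ℝ (fun y => A (φ y)) (s, x) :=
      DifferentiableAt.comp (g := A) (f := φ) (s, x) dA hφd
    have dBφ : DifferentiableAt ℝ (fun y => B (φ y)) (s, x) :=
      DifferentiableAt.comp (g := B) (f := φ) (s, x) dB hφd
    have dF : DifferentiableAt ℝ F (s, x) := differentiableAt_fst.mul (dAφ.sub dBφ)
    have dG : DifferentiableAt ℝ G (s, x) :=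
      ((differentiableAt_snd.mul dAφ).add
        (((differentiableAt_const _).sub differentiableAt_snd).mul dBφ)).neg
    refine ⟨dF, dG, ?_⟩
    have i1 : HasDerivAt (fun σ : ℝ => ((σ, x) : ℝ × ℝ)) (1, 0) s :=
      (hasDerivAt_id _).prodMk (hasDerivAt_const _ _)
    have i2 : HasDerivAt (fun ξ : ℝ => ((s, ξ) : ℝ × ℝ)) (0, 1) x :=
      (hasDerivAt_const _ _).prodMk (hasDerivAt_id _)
    have p1 : HasDerivAt (fun σ : ℝ => φ (σ, x)) (2 - x, x) s := by
      have e1 : HasDerivAt (fun σ : ℝ => 2 * σ - σ * x) (2 - x) s :=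
        (((hasDerivAt_id' s).const_mul 2).sub ((hasDerivAt_id' s).mul_const x)).congr_deriv
          (by ring)
      have e2 : HasDerivAt (fun σ : ℝ => σ * x) x s := by
        simpa using (hasDerivAt_id s).mul_const x
      exact e1.prodMk e2
    have p2 : HasDerivAt (fun ξ : ℝ => φ (s, ξ)) (-s, s) x := by
      have e1 : HasDerivAt (fun ξ : ℝ => 2 * s - s * ξ) (-s) x := by
        simpa using ((hasDerivAt_id x).const_mul s).const_sub (2 * s)
      have e2 : HasDerivAt (fun ξ : ℝ => s * ξ) s x := by
        simpa using (hasDerivAt_id x).const_mul s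
      exact e1.prodMk e2
    have lin : ∀ (L : ℝ × ℝ →L[ℝ] ℝ) (v w : ℝ), L (v, w) = v * L (1, 0) + w * L (0, 1) := by
      intro L v w
      have : ((v, w) : ℝ × ℝ) = v • ((1, 0) : ℝ × ℝ) + w • ((0, 1) : ℝ × ℝ) := by simp
      rw [this, map_add, map_smul, map_smul, smul_eq_mul, smul_eq_mul]
    have A1 : HasDerivAt (fun σ : ℝ => A (φ (σ, x))) (fderiv ℝ A z (2 - x, x)) s :=
      dA.hasFDerivAt.comp_hasDerivAt s p1
    have B1 : HasDerivAt (fun σ : ℝ => B (φ (σ, x))) (fderiv ℝ B z (2 - x, x)) s :=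
      dB.hasFDerivAt.comp_hasDerivAt s p1
    have A2 : HasDerivAt (fun ξ : ℝ => A (φ (s, ξ))) (fderiv ℝ A z (-s, s)) x :=
      dA.hasFDerivAt.comp_hasDerivAt x p2
    have B2 : HasDerivAt (fun ξ : ℝ => B (φ (s, ξ))) (fderiv ℝ B z (-s, s)) x :=
      dB.hasFDerivAt.comp_hasDerivAt x p2
    rw [lin] at A1 B1 A2 B2
    have F1 : HasDerivAt (fun σ : ℝ => F (σ, x)) _ s := (hasDerivAt_id' s).mul (A1.sub B1)
    have G1 : HasDerivAt (fun ξ : ℝ => G (s, ξ)) _ x :=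
      (((hasDerivAt_id' x).mul A2).add (((hasDerivAt_id' x).const_sub 2).mul B2)).neg
    have F2 : HasDerivAt (fun σ : ℝ => F (σ, x)) (fderiv ℝ F (s, x) (1, 0)) s :=
      HasFDerivAt.comp_hasDerivAt (l := F) s dF.hasFDerivAt i1
    have G2 : HasDerivAt (fun ξ : ℝ => G (s, ξ)) (fderiv ℝ G (s, x) (0, 1)) x :=
      HasFDerivAt.comp_hasDerivAt (l := G) x dG.hasFDerivAt i2
    rw [F2.unique F1, G2.unique G1]
    simp only []
    rw [← hac, ← ha', ← hc']
    simp only [← hz]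
    ring
  classical
  have key := integral2_divergence_prod_of_hasFDerivAt_off_countable F G
    (fun y => if y ∈ I then fderiv ℝ F y
      else (2 * (y.1 * b (φ y))) • ContinuousLinearMap.fst ℝ ℝ ℝ)
    (fun y => if y ∈ I then fderiv ℝ G y else 0) s₀ 0 s₁ 1 ∅ countable_empty hFc hGc
    (by
      intro y hy
      rw [min_eq_left h01, max_eq_right h01, min_eq_left zero_le_one, max_eq_right zero_le_one,
        sdiff_empty] at hy
      simp only [hI, if_pos hy]
      exact (hdiff y hy).1.hasFDerivAt)
    (by
      intro y hy
      rw [min_eq_left h01, max_eq_right h01, min_eq_left zero_le_one, max_eq_right zero_le_one,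
        sdiff_empty] at hy
      simp only [hI, if_pos hy]
      exact (hdiff y hy).2.1.hasFDerivAt)
  have hsum : ∀ y : ℝ × ℝ, (if y ∈ I then fderiv ℝ F y
      else (2 * (y.1 * b (φ y))) • ContinuousLinearMap.fst ℝ ℝ ℝ) (1, 0) +
      (if y ∈ I then fderiv ℝ G y else 0) (0, 1) = 2 * (y.1 * b (φ y)) := by
    intro y
    by_cases hy : y ∈ I
    · simp only [if_pos hy]
      exact (hdiff y hy).2.2
    · simp [if_neg hy]
  simp only [hsum] at key
  have key := key (ContinuousOn.integrableOn_compact (isCompact_uIcc.prod isCompact_uIcc)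
    (continuousOn_const.mul (continuousOn_fst.mul hbc)))
  have e1 : ∀ s, ∫ x in (0 : ℝ)..1, 2 * (s * b (φ (s, x))) = 2 * coneInt b s := by
    intro s
    rw [intervalIntegral.integral_const_mul, intervalIntegral.integral_const_mul,
      coneInt_eq_rescaled]
  have e2 : ∀ s, ∫ x in (0 : ℝ)..1, F (s, x) = coneInt (fun z => A z - B z) s := by
    intro s
    rw [coneInt_eq_rescaled, ← intervalIntegral.integral_const_mul]
  have e3 : ∀ s, G (s, 1) = -(A (s, s) + B (s, s)) := by
    intro s
    simp only [hG, hφ]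
    rw [show 2 * s - s * 1 = s by ring, show s * 1 = s by ring]
    ring
  have e4 : ∀ s, G (s, 0) = 0 := by
    intro s
    simp [hG, hφ, hB0]
  simp only [e1, e2, e3, e4, intervalIntegral.integral_neg, intervalIntegral.integral_zero] at key
  linarith

/-- The nonlinearity `v - sin v cos v`. -/
noncomputable def skyrme (v : ℝ) : ℝ := v - Real.sin v * Real.cos v

lemma hasDerivAt_skyrme (v : ℝ) : HasDerivAt skyrme (2 * Real.sin v ^ 2) v := by
  refine ((hasDerivAt_id' v).sub ((Real.hasDerivAt_sin v).mul
    (Real.hasDerivAt_cos v))).congr_deriv ?_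
  nlinarith [Real.sin_sq_add_cos_sq v]

lemma contDiff_skyrme : ContDiff ℝ (⊤ : ℕ∞) skyrme :=
  contDiff_id.sub (Real.contDiff_sin.mul Real.contDiff_cos)

lemma abs_skyrme_le (v : ℝ) : |skyrme v| ≤ 2 * |v| ^ 3 := by
  have h := Convex.norm_image_sub_le_of_norm_deriv_le (𝕜 := ℝ) (f := skyrme)
    (s := Metric.closedBall 0 |v|) (x := 0) (y := v) (C := 2 * |v| ^ 2)
    (fun x _ => (hasDerivAt_skyrme x).differentiableAt)
    (fun x hx => by
      rw [(hasDerivAt_skyrme x).deriv, Real.norm_eq_abs, abs_of_nonneg (by positivity)]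
      have hx' : |x| ≤ |v| := by simpa using hx
      have := sq_le_sq.2 (Real.abs_sin_le_abs (x := x))
      have := sq_le_sq.2 hx'
      rw [sq_abs]
      linarith)
    (convex_closedBall _ _) (by simp) (by simp)
  simp only [skyrme, sub_zero, Real.sin_zero, zero_mul, Real.norm_eq_abs] at h
  calc |skyrme v| ≤ _ := h
    _ = _ := by ring

lemma mul_sin_two_le (v : ℝ) : |v * Real.sin (2 * v)| ≤ 2 * v ^ 2 := by
  have h := Real.abs_sin_le_abs (x := 2 * v)
  rw [abs_mul, abs_of_pos (two_pos : (0 : ℝ) < 2)] at h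
  rw [abs_mul, ← sq_abs v]
  nlinarith [abs_nonneg v]

lemma mul_skyrme_nonneg (v : ℝ) : 0 ≤ v * skyrme v := by
  have h := (abs_le.1 (mul_sin_two_le v)).2
  rw [Real.sin_two_mul] at h
  unfold skyrme
  nlinarith

lemma sq_le_skyrme_sq (v : ℝ) : v ^ 2 ≤ 2 * skyrme v ^ 2 + 1 / 2 := by
  have h : (Real.sin v * Real.cos v) ^ 2 ≤ 1 / 4 := by
    rw [mul_pow]
    nlinarith [Real.sin_sq_add_cos_sq v, sq_nonneg (Real.sin v ^ 2 - Real.cos v ^ 2)]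
  have aux : ∀ a b : ℝ, b ^ 2 ≤ 1 / 4 → (a + b) ^ 2 ≤ 2 * a ^ 2 + 1 / 2 := fun a b hb => by
    nlinarith [sq_nonneg (a - b)]
  have := aux (skyrme v) _ h
  rwa [show skyrme v + Real.sin v * Real.cos v = v by unfold skyrme; ring] at this

lemma eq_zero_of_skyrme_eq_zero {v : ℝ} (h : skyrme v = 0) : v = 0 := by
  by_contra hv
  have h1 : v = Real.sin (2 * v) / 2 := by
    rw [Real.sin_two_mul]; unfold skyrme at h; linarith
  have h2 : |Real.sin (2 * v)| < |2 * v| := by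
    have := Real.abs_sin_lt_abs (x := 2 * v) (by simpa using hv)
    exact this
  rw [show Real.sin (2 * v) = 2 * v by linarith] at h2
  exact lt_irrefl _ h2

/-- Partial derivatives of a smooth function of two variables. -/
lemma hasDerivAt_fst_of_contDiffOn {V : Set (ℝ × ℝ)} (hV : IsOpen V) {F : ℝ × ℝ → ℝ}
    (hF : ContDiffOn ℝ (⊤ : ℕ∞) F V) {z : ℝ × ℝ} (hz : z ∈ V) :
    HasDerivAt (fun s => F (s, z.2)) (fderiv ℝ F z (1, 0)) z.1 := by
  have hd : DifferentiableAt ℝ F z :=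
    (hF.contDiffAt (hV.mem_nhds hz)).differentiableAt (by simp)
  have h1 : HasDerivAt (fun t : ℝ => ((t, z.2) : ℝ × ℝ)) (1, 0) z.1 :=
    (hasDerivAt_id _).prodMk (hasDerivAt_const _ _)
  exact HasFDerivAt.comp_hasDerivAt (l := F) z.1 hd.hasFDerivAt h1

lemma hasDerivAt_snd_of_contDiffOn {V : Set (ℝ × ℝ)} (hV : IsOpen V) {F : ℝ × ℝ → ℝ}
    (hF : ContDiffOn ℝ (⊤ : ℕ∞) F V) {z : ℝ × ℝ} (hz : z ∈ V) :
    HasDerivAt (fun s => F (z.1, s)) (fderiv ℝ F z (0, 1)) z.2 := by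
  have hd : DifferentiableAt ℝ F z :=
    (hF.contDiffAt (hV.mem_nhds hz)).differentiableAt (by simp)
  have h1 : HasDerivAt (fun t : ℝ => ((z.1, t) : ℝ × ℝ)) (0, 1) z.2 :=
    (hasDerivAt_const _ _).prodMk (hasDerivAt_id _)
  exact HasFDerivAt.comp_hasDerivAt (l := F) z.2 hd.hasFDerivAt h1

lemma contDiffOn_fderiv_apply {V : Set (ℝ × ℝ)} (hV : IsOpen V) {F : ℝ × ℝ → ℝ}
    (hF : ContDiffOn ℝ (⊤ : ℕ∞) F V) (v : ℝ × ℝ) :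
    ContDiffOn ℝ (⊤ : ℕ∞) (fun z => fderiv ℝ F z v) V :=
  (hF.fderiv_of_isOpen hV (by simp)).clm_apply contDiffOn_const

section Regularity

variable {u : ℝ → ℝ → ℝ} {V : Set (ℝ × ℝ)}

lemma ut_eq_fderiv_s12 (hV : IsOpen V) (hu : ContDiffOn ℝ (⊤ : ℕ∞) (fun p : ℝ × ℝ => u p.1 p.2) V)
    {z : ℝ × ℝ} (hz : z ∈ V) :
    ut u z.1 z.2 = fderiv ℝ (fun p : ℝ × ℝ => u p.1 p.2) z (1, 0) :=
  (hasDerivAt_fst_of_contDiffOn hV hu hz).deriv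

lemma ur_eq_fderiv_s12 (hV : IsOpen V) (hu : ContDiffOn ℝ (⊤ : ℕ∞) (fun p : ℝ × ℝ => u p.1 p.2) V)
    {z : ℝ × ℝ} (hz : z ∈ V) :
    ur u z.1 z.2 = fderiv ℝ (fun p : ℝ × ℝ => u p.1 p.2) z (0, 1) :=
  (hasDerivAt_snd_of_contDiffOn hV hu hz).deriv

lemma contDiffOn_ut (hV : IsOpen V)
    (hu : ContDiffOn ℝ (⊤ : ℕ∞) (fun p : ℝ × ℝ => u p.1 p.2) V) :
    ContDiffOn ℝ (⊤ : ℕ∞) (fun p : ℝ × ℝ => ut u p.1 p.2) V :=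
  (contDiffOn_fderiv_apply hV hu (1, 0)).congr fun _ hz => ut_eq_fderiv_s12 hV hu hz

lemma contDiffOn_ur (hV : IsOpen V)
    (hu : ContDiffOn ℝ (⊤ : ℕ∞) (fun p : ℝ × ℝ => u p.1 p.2) V) :
    ContDiffOn ℝ (⊤ : ℕ∞) (fun p : ℝ × ℝ => ur u p.1 p.2) V :=
  (contDiffOn_fderiv_apply hV hu (0, 1)).congr fun _ hz => ur_eq_fderiv_s12 hV hu hz

lemma contDiffOn_utt (hV : IsOpen V)
    (hu : ContDiffOn ℝ (⊤ : ℕ∞) (fun p : ℝ × ℝ => u p.1 p.2) V) :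
    ContDiffOn ℝ (⊤ : ℕ∞) (fun p : ℝ × ℝ => utt u p.1 p.2) V :=
  contDiffOn_ut (u := ut u) hV (contDiffOn_ut hV hu)

lemma contDiffOn_urr (hV : IsOpen V)
    (hu : ContDiffOn ℝ (⊤ : ℕ∞) (fun p : ℝ × ℝ => u p.1 p.2) V) :
    ContDiffOn ℝ (⊤ : ℕ∞) (fun p : ℝ × ℝ => urr u p.1 p.2) V :=
  contDiffOn_ur (u := ur u) hV (contDiffOn_ur hV hu)

lemma hasDerivAt_ut_s12 (hV : IsOpen V)
    (hu : ContDiffOn ℝ (⊤ : ℕ∞) (fun p : ℝ × ℝ => u p.1 p.2) V) {z : ℝ × ℝ} (hz : z ∈ V) :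
    HasDerivAt (fun s => u s z.2) (ut u z.1 z.2) z.1 := by
  rw [ut_eq_fderiv_s12 hV hu hz]
  exact hasDerivAt_fst_of_contDiffOn hV hu hz

lemma hasDerivAt_ur_s12 (hV : IsOpen V)
    (hu : ContDiffOn ℝ (⊤ : ℕ∞) (fun p : ℝ × ℝ => u p.1 p.2) V) {z : ℝ × ℝ} (hz : z ∈ V) :
    HasDerivAt (fun s => u z.1 s) (ur u z.1 z.2) z.2 := by
  rw [ur_eq_fderiv_s12 hV hu hz]
  exact hasDerivAt_snd_of_contDiffOn hV hu hz

lemma ut_ur_eq_ur_ut_s12 (hV : IsOpen V)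
    (hu : ContDiffOn ℝ (⊤ : ℕ∞) (fun p : ℝ × ℝ => u p.1 p.2) V) {z : ℝ × ℝ} (hz : z ∈ V) :
    ut (ur u) z.1 z.2 = ur (ut u) z.1 z.2 := by
  rw [ut_eq_fderiv_s12 hV (contDiffOn_ur hV hu) hz, ur_eq_fderiv_s12 hV (contDiffOn_ut hV hu) hz]
  have hn := hV.mem_nhds hz
  have e1 : (fun p : ℝ × ℝ => ur u p.1 p.2) =ᶠ[𝓝 z]
      fun y => fderiv ℝ (fun p : ℝ × ℝ => u p.1 p.2) y (0, 1) :=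
    Filter.mem_of_superset hn fun y hy => ur_eq_fderiv_s12 hV hu hy
  have e2 : (fun p : ℝ × ℝ => ut u p.1 p.2) =ᶠ[𝓝 z]
      fun y => fderiv ℝ (fun p : ℝ × ℝ => u p.1 p.2) y (1, 0) :=
    Filter.mem_of_superset hn fun y hy => ut_eq_fderiv_s12 hV hu hy
  have hd : DifferentiableAt ℝ (fderiv ℝ (fun p : ℝ × ℝ => u p.1 p.2)) z :=
    (((hu.fderiv_of_isOpen hV (m := (⊤ : ℕ∞)) (by simp)).contDiffAt hn)).differentiableAt (by simp)
  rw [e1.fderiv_eq, e2.fderiv_eq, fderiv_clm_apply hd (by fun_prop),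
    fderiv_clm_apply hd (by fun_prop)]
  have hs : IsSymmSndFDerivAt ℝ (fun p : ℝ × ℝ => u p.1 p.2) z :=
    (hu.contDiffAt hn).isSymmSndFDerivAt (by
      rw [minSmoothness_of_isRCLikeNormedField]
      exact WithTop.coe_le_coe.2 (le_top : (2 : ℕ∞) ≤ ⊤))
  simpa using hs (1, 0) (0, 1)

end Regularity

lemma coneRegion_subset_Dom {T : ℝ} (hT : 0 < T) : coneRegion (T / 2) ⊆ Dom T := by
  rintro ⟨t, r⟩ ⟨h1, h2, h3, h4⟩
  simp only at h1 h2 h3 h4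
  refine ⟨h1, by simp only; linarith, h2, le_min ?_ h3⟩
  simp only; linarith

lemma axis_mem_Dom {T t : ℝ} (h0 : 0 < t) (hT : t < 2 * T) : (t, (0 : ℝ)) ∈ Dom T :=
  ⟨h0, hT.le, le_rfl, le_min (by simp only; linarith) h0.le⟩

/-- The equation forces the sine of the solution to vanish on the axis. -/
lemma sin_axis_eq_zero {u : ℝ → ℝ → ℝ} {T : ℝ} (h : BackwardFramework u T) {t : ℝ}
    (h0 : 0 < t) (hT : t < 2 * T) : Real.sin (u t 0) = 0 := by
  obtain ⟨-, ⟨V, hV, hDV, hu⟩, heq, -⟩ := h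
  have hmem := hDV (axis_mem_Dom h0 hT)
  have hn := hV.mem_nhds hmem
  have hmap : Tendsto (fun r : ℝ => (t, r)) (𝓝[>] 0) (𝓝 (t, 0)) :=
    ((Continuous.prodMk_right t).tendsto 0).mono_left nhdsWithin_le_nhds
  have cont : ∀ g : ℝ → ℝ → ℝ, ContDiffOn ℝ (⊤ : ℕ∞) (fun p : ℝ × ℝ => g p.1 p.2) V →
      Tendsto (fun r => g t r) (𝓝[>] 0) (𝓝 (g t 0)) := fun g hg =>
    Tendsto.comp (g := fun p : ℝ × ℝ => g p.1 p.2) (hg.continuousOn.continuousAt hn) hmap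
  have hr : Tendsto (fun r : ℝ => r) (𝓝[>] 0) (𝓝 0) :=
    tendsto_id.mono_left nhdsWithin_le_nhds
  have c0 := cont u hu
  have c1 := cont _ (contDiffOn_utt hV hu)
  have c2 := cont _ (contDiffOn_urr hV hu)
  have c3 := cont _ (contDiffOn_ur hV hu)
  have c4 := ((hr.pow 4).mul (c1.sub c2)).sub (((hr.pow 3).const_mul 2).mul c3)
  have csin := (Real.continuous_sin.tendsto _).comp (c0.const_mul 2)
  have c5 := c4.add ((hr.pow 2).mul csin)
  have cf := (contDiff_skyrme.continuous.tendsto _).comp c0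
  have ccos := (Real.continuous_cos.tendsto _).comp (c0.const_mul 2)
  have c6 := c5.add (cf.mul (ccos.const_sub 1))
  have hz : ∀ᶠ r in 𝓝[>] (0 : ℝ), r ^ 4 * (utt u t r - urr u t r) - 2 * r ^ 3 * ur u t r +
      r ^ 2 * Real.sin (2 * u t r) + skyrme (u t r) * (1 - Real.cos (2 * u t r)) = 0 := by
    have : Ioo (0 : ℝ) (min (2 * T - t) t) ∈ 𝓝[>] (0 : ℝ) :=
      Ioo_mem_nhdsGT (lt_min (by linarith) h0)
    filter_upwards [this] with r hr
    have e := heq (t, r) ⟨h0, hT.le, hr.1.le, hr.2.le⟩ hr.1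
    have hr0 : r ≠ 0 := hr.1.ne'
    unfold ANeq at e
    simp only at e
    have e' := congrArg (fun x => r ^ 4 * x) e
    simp only [mul_zero] at e'
    rw [← e']
    unfold skyrme
    field_simp
  have hlim := tendsto_nhds_unique (c6.congr' (hz.mono fun r hr => by
    simpa [Function.comp] using hr)) tendsto_const_nhds
  simp only [ne_eq, OfNat.ofNat_ne_zero, not_false_eq_true, zero_pow, zero_mul, mul_zero,
    sub_zero, zero_add] at hlim
  rcases mul_eq_zero.1 hlim with h1 | h1
  · rw [eq_zero_of_skyrme_eq_zero h1, Real.sin_zero]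
  · rw [Real.cos_two_mul] at h1
    have : Real.sin (u t 0) ^ 2 = 0 := by
      nlinarith [Real.sin_sq_add_cos_sq (u t 0)]
    exact pow_eq_zero_iff two_ne_zero |>.1 this

/-- Finite energy forces the solution to vanish at the point `(T, 0)`. -/
lemma axis_eq_zero_of_finite_energy {u : ℝ → ℝ → ℝ} {T : ℝ} (h : BackwardFramework u T) :
    u T 0 = 0 := by
  obtain ⟨hT, ⟨V, hV, hDV, hu⟩, -, hfin⟩ := h
  by_contra hne
  have hmem := hDV (axis_mem_Dom hT (by linarith : T < 2 * T))
  have hn := hV.mem_nhds hmem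
  have hf : 0 < skyrme (u T 0) ^ 2 := by
    have : skyrme (u T 0) ≠ 0 := fun h => hne (eq_zero_of_skyrme_eq_zero h)
    positivity
  have hc : ContinuousAt (fun r => skyrme (u T r) ^ 2) 0 := by
    have h1 : ContinuousAt (fun p : ℝ × ℝ => u p.1 p.2) (T, 0) :=
      hu.continuousOn.continuousAt hn
    have h2 : ContinuousAt (fun r => u T r) 0 :=
      ContinuousAt.comp (f := fun r : ℝ => (T, r)) (g := fun p : ℝ × ℝ => u p.1 p.2) h1
        (Continuous.prodMk_right T).continuousAt
    exact (ContinuousAt.comp (g := skyrme) contDiff_skyrme.continuous.continuousAt h2).pow 2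
  obtain ⟨δ, hδ, hball⟩ := Metric.eventually_nhds_iff.1
    (hc.eventually (lt_mem_nhds (half_lt_self hf)))
  set c := skyrme (u T 0) ^ 2 with hcdef
  set ρ := min (min (δ / 2) T) 1 with hρ
  have hρ0 : 0 < ρ := by positivity
  have hρδ : ρ < δ := by
    have : ρ ≤ δ / 2 := (min_le_left _ _).trans (min_le_left _ _)
    linarith
  have hρT : ρ ≤ T := (min_le_left _ _).trans (min_le_right _ _)
  have hρ1 : ρ ≤ 1 := min_le_right _ _
  have hi := (hfin.mono_set (Ioc_subset_Ioc_right hρT)).const_mul (4 / c)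
  have hinv : IntegrableOn (fun r : ℝ => r⁻¹) (Ioc 0 ρ) := by
    refine Integrable.mono' hi (by fun_prop) ?_
    refine (ae_restrict_mem measurableSet_Ioc).mono fun r hr => ?_
    have h1 := hball (y := r) (by
      rw [Real.dist_eq, sub_zero, abs_of_pos hr.1]; exact hr.2.trans_lt hρδ)
    have hr0 := hr.1
    have hr1 : r ≤ 1 := hr.2.trans hρ1
    rw [Real.norm_eq_abs, abs_of_pos (inv_pos.2 hr0)]
    have h2 : skyrme (u T r) ^ 2 / (2 * r ^ 2) ≤ eDens u T r * r ^ 2 := by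
      have : eDens u T r * r ^ 2 = skyrme (u T r) ^ 2 / (2 * r ^ 2) +
          ((1 / 2) * (ut u T r ^ 2 + ur u T r ^ 2) * r ^ 2 + Real.sin (u T r) ^ 2) := by
        unfold eDens skyrme
        field_simp
        ring
      rw [this]
      have : 0 ≤ (1 / 2) * (ut u T r ^ 2 + ur u T r ^ 2) * r ^ 2 + Real.sin (u T r) ^ 2 := by
        positivity
      linarith
    calc r⁻¹ ≤ 4 / c * (c / 2 / (2 * r ^ 2)) := by
          rw [show 4 / c * (c / 2 / (2 * r ^ 2)) = (r ^ 2)⁻¹ by field_simp; norm_num]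
          exact inv_anti₀ (by positivity) (by nlinarith)
      _ ≤ 4 / c * (skyrme (u T r) ^ 2 / (2 * r ^ 2)) := by gcongr
      _ ≤ _ := by gcongr
  have := (intervalIntegrable_iff_integrableOn_Ioc_of_le hρ0.le).2 hinv
  rw [intervalIntegrable_inv_iff] at this
  rcases this with h | h
  · exact hρ0.ne h
  · exact h left_mem_uIcc

/-- A solution in the backward framework vanishes on the axis. -/
lemma axis_eq_zero {u : ℝ → ℝ → ℝ} {T : ℝ} (h : BackwardFramework u T) {t : ℝ}
    (h0 : 0 < t) (hT : t < 2 * T) : u t 0 = 0 := by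
  have hT0 := h.1
  have key := axis_eq_zero_of_finite_energy h
  obtain ⟨V, hV, hDV, hu⟩ := h.2.1
  have hd : ∀ s ∈ Ioo 0 (2 * T), HasDerivAt (fun s => u s 0) (ut u s 0) s := fun s hs =>
    hasDerivAt_ut_s12 hV hu (z := (s, 0)) (hDV (axis_mem_Dom hs.1 hs.2))
  refine Eq.trans ?_ key
  refine isOpen_Ioo.is_const_of_deriv_eq_zero (𝕜 := ℝ) (f := fun s => u s 0)
    isPreconnected_Ioo (fun s hs => (hd s hs).differentiableAt.differentiableWithinAt)
    (fun s hs => ?_) (⟨h0, hT⟩ : t ∈ Ioo 0 (2 * T)) ⟨hT0, by linarith⟩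
  rw [(hd s hs).deriv]
  have e1 : HasDerivAt (fun s => Real.sin (u s 0)) (Real.cos (u s 0) * ut u s 0) s :=
    (hd s hs).sin
  have e2 : HasDerivAt (fun s => Real.sin (u s 0)) 0 s :=
    (hasDerivAt_const s (0 : ℝ)).congr_of_eventuallyEq
      (Filter.mem_of_superset (isOpen_Ioo.mem_nhds hs) fun y hy => sin_axis_eq_zero h hy.1 hy.2)
  have hs0 := sin_axis_eq_zero h hs.1 hs.2
  have hcos : Real.cos (u s 0) ≠ 0 := by
    intro hc
    have := Real.sin_sq_add_cos_sq (u s 0)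
    rw [hc, hs0] at this
    norm_num at this
  exact (mul_eq_zero.1 (e1.unique e2)).resolve_left hcos

/-- The quotient `(u - sin u cos u) / r²`. -/
noncomputable def skyrmeQuot (u : ℝ → ℝ → ℝ) (z : ℝ × ℝ) : ℝ := skyrme (u z.1 z.2) / z.2 ^ 2

lemma continuousOn_skyrmeQuot {u : ℝ → ℝ → ℝ} {T : ℝ} (h : BackwardFramework u T) :
    ContinuousOn (skyrmeQuot u) (coneRegion (T / 2)) := by
  obtain ⟨V, hV, hDV, hu⟩ := h.2.1
  have hT := h.1
  intro z hz
  have hzV := hDV (coneRegion_subset_Dom hT hz)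
  have hn := hV.mem_nhds hzV
  have hcu : ContinuousAt (fun p : ℝ × ℝ => u p.1 p.2) z := hu.continuousOn.continuousAt hn
  rcases hz.2.1.eq_or_lt with h0 | h0
  · obtain ⟨C, W, hW, hL⟩ := ((hu.contDiffAt hn).of_le
      (by exact mod_cast le_top)).exists_lipschitzOnWith (𝕂 := ℝ)
    have hz0 : skyrmeQuot u z = 0 := by simp [skyrmeQuot, ← h0]
    unfold ContinuousWithinAt
    rw [hz0]
    have hax : Tendsto (fun y : ℝ × ℝ => (y.1, (0 : ℝ))) (𝓝 z) (𝓝 z) := by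
      have : Continuous (fun y : ℝ × ℝ => (y.1, (0 : ℝ))) := by fun_prop
      have := this.tendsto z
      rwa [show (z.1, (0 : ℝ)) = z from Prod.ext rfl h0] at this
    have hlim : Tendsto (fun y : ℝ × ℝ => 2 * (C : ℝ) ^ 3 * y.2) (𝓝[coneRegion (T / 2)] z)
        (𝓝 0) := by
      have : Continuous (fun y : ℝ × ℝ => 2 * (C : ℝ) ^ 3 * y.2) := by fun_prop
      have := this.tendsto z
      rw [← h0, mul_zero] at this
      exact this.mono_left nhdsWithin_le_nhds
    refine squeeze_zero_norm' ?_ hlim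
    filter_upwards [self_mem_nhdsWithin, nhdsWithin_le_nhds hW,
      nhdsWithin_le_nhds (hax hW)] with y hy hyW hyW'
    have hyax : u y.1 0 = 0 := by
      have := hy.2.1
      have := hy.2.2.2
      exact axis_eq_zero h hy.1 (by linarith)
    have hLy := hL.dist_le_mul y hyW _ hyW'
    simp only [hyax, Real.dist_eq, sub_zero] at hLy
    have hd : dist y (y.1, (0 : ℝ)) = y.2 := by
      rw [Prod.dist_eq, dist_self, Real.dist_eq, sub_zero, abs_of_nonneg hy.2.1,
        max_eq_right hy.2.1]
    rw [hd] at hLy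
    rw [Real.norm_eq_abs, skyrmeQuot, abs_div, abs_of_nonneg (sq_nonneg y.2)]
    rcases hy.2.1.eq_or_lt with h1 | h1
    · simp [← h1]
    · rw [div_le_iff₀ (by positivity)]
      calc |skyrme (u y.1 y.2)| ≤ 2 * |u y.1 y.2| ^ 3 := abs_skyrme_le _
        _ ≤ 2 * (C * y.2) ^ 3 := by gcongr
        _ = _ := by ring
  · refine ContinuousAt.continuousWithinAt ?_
    exact (ContinuousAt.comp (g := skyrme) contDiff_skyrme.continuous.continuousAt hcu).div
      (continuousAt_snd.pow 2) (by positivity)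

/-- A solution `U` on `coneRegion S`, with `P = U_t`, `Q = U_r`, `K = (U - sin U cos U) / r²`. -/
structure ConeSolution (S : ℝ) (U P Q K : ℝ × ℝ → ℝ) : Prop where
  contU : ContinuousOn U (coneRegion S)
  contP : ContinuousOn P (coneRegion S)
  contQ : ContinuousOn Q (coneRegion S)
  contK : ContinuousOn K (coneRegion S)
  diffU : ∀ z ∈ coneRegion S, 0 < z.2 → DifferentiableAt ℝ U z
  diffP : ∀ z ∈ coneRegion S, 0 < z.2 → DifferentiableAt ℝ P z
  diffQ : ∀ z ∈ coneRegion S, 0 < z.2 → DifferentiableAt ℝ Q z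
  diffK : ∀ z ∈ coneRegion S, 0 < z.2 → DifferentiableAt ℝ K z
  quot : ∀ z ∈ coneRegion S, z.2 ^ 2 * K z = skyrme (U z)
  mul_quot_nonneg : ∀ z, 0 ≤ U z * K z
  eqn : ∀ t r, (t, r) ∈ coneRegion S → 0 < r → ∃ p m q,
    HasDerivAt (fun s => U (s, r)) (P (t, r)) t ∧ HasDerivAt (fun s => U (t, s)) (Q (t, r)) r ∧
    HasDerivAt (fun s => P (s, r)) p t ∧ HasDerivAt (fun s => P (t, s)) m r ∧
    HasDerivAt (fun s => Q (s, r)) m t ∧ HasDerivAt (fun s => Q (t, s)) q r ∧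
    HasDerivAt (fun s => K (s, r)) (2 * Real.sin (U (t, r)) ^ 2 * P (t, r) / r ^ 2) t ∧
    HasDerivAt (fun s => K (t, s))
      (2 * Real.sin (U (t, r)) ^ 2 * Q (t, r) / r ^ 2 - 2 * K (t, r) / r) r ∧
    p = q + (2 / r) * Q (t, r) - 2 * Real.sin (U (t, r)) * Real.cos (U (t, r)) / r ^ 2 -
      2 * K (t, r) * Real.sin (U (t, r)) ^ 2 / r ^ 2

lemma BackwardFramework.coneSolution {u : ℝ → ℝ → ℝ} {T : ℝ} (h : BackwardFramework u T) :
    ConeSolution (T / 2) (fun z => u z.1 z.2) (fun z => ut u z.1 z.2) (fun z => ur u z.1 z.2)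
      (skyrmeQuot u) := by
  obtain ⟨V, hV, hDV, hu⟩ := h.2.1
  have hT := h.1
  have hDV' : coneRegion (T / 2) ⊆ V := (coneRegion_subset_Dom hT).trans hDV
  have hP := contDiffOn_ut hV hu
  have hQ := contDiffOn_ur hV hu
  have hd : ∀ F : ℝ × ℝ → ℝ, ContDiffOn ℝ (⊤ : ℕ∞) F V →
      ∀ z ∈ coneRegion (T / 2), 0 < z.2 → DifferentiableAt ℝ F z := fun F hF z hz _ =>
    (hF.contDiffAt (hV.mem_nhds (hDV' hz))).differentiableAt (by simp)
  refine ⟨hu.continuousOn.mono hDV', hP.continuousOn.mono hDV', hQ.continuousOn.mono hDV',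
    continuousOn_skyrmeQuot h, hd _ hu, hd _ hP, hd _ hQ, ?_, ?_, ?_, ?_⟩
  · intro z hz hr
    have h1 : DifferentiableAt ℝ (fun z : ℝ × ℝ => skyrme (u z.1 z.2)) z :=
      DifferentiableAt.comp (g := skyrme) z (hasDerivAt_skyrme _).differentiableAt (hd _ hu z hz hr)
    have h2 : DifferentiableAt ℝ (fun z : ℝ × ℝ => z.2 ^ 2) z := by fun_prop
    have h3 : skyrmeQuot u = (fun z => skyrme (u z.1 z.2)) * (fun z => z.2 ^ 2)⁻¹ :=
      funext fun w => div_eq_mul_inv _ _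
    rw [h3]
    exact h1.mul (h2.inv (by positivity))
  · intro z hz
    rcases hz.2.1.eq_or_lt with h0 | h0
    · have : u z.1 z.2 = 0 := by
        rw [← h0]
        have h1 := hz.2.2.2
        rw [← h0] at h1
        exact axis_eq_zero h hz.1 (by linarith)
      simp only [this, skyrmeQuot]
      simp [skyrme]
    · unfold skyrmeQuot
      field_simp
  · intro z
    unfold skyrmeQuot
    rw [← mul_div_assoc]
    exact div_nonneg (mul_skyrme_nonneg _) (sq_nonneg _)
  · intro t r hz hr
    have hm := hDV' hz
    have Ut := hasDerivAt_ut_s12 hV hu hm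
    have Ur := hasDerivAt_ur_s12 hV hu hm
    have Pt := hasDerivAt_ut_s12 (u := ut u) hV hP hm
    have Pr := hasDerivAt_ur_s12 (u := ut u) hV hP hm
    have Qt := hasDerivAt_ut_s12 (u := ur u) hV hQ hm
    have Qr := hasDerivAt_ur_s12 (u := ur u) hV hQ hm
    rw [ut_ur_eq_ur_ut_s12 hV hu hm] at Qt
    refine ⟨_, _, _, Ut, Ur, Pt, Pr, Qt, Qr, ?_, ?_, ?_⟩
    · exact (HasDerivAt.comp (h₂ := skyrme) t (hasDerivAt_skyrme (u t r)) Ut).div_const (r ^ 2)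
    · have h1 := HasDerivAt.comp (h₂ := skyrme) r (hasDerivAt_skyrme (u t r)) Ur
      refine (h1.div (hasDerivAt_pow 2 r) (by positivity)).congr_deriv ?_
      simp only [skyrmeQuot, Function.comp]
      field_simp
      push_cast
      ring
    · have e := h.2.2.1 (t, r) (coneRegion_subset_Dom hT hz) hr
      unfold ANeq at e
      simp only [Real.sin_two_mul, Real.cos_two_mul, Real.cos_sq'] at e
      change utt u t r = urr u t r + _ - _ - _
      simp only [skyrmeQuot]
      rw [show u t r - Real.sin (u t r) * Real.cos (u t r) = skyrme (u t r) from rfl] at e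
      have e2 : skyrme (u t r) * (1 - (2 * (1 - Real.sin (u t r) ^ 2) - 1)) / r ^ 4 =
          2 * (skyrme (u t r) / r ^ 2) * Real.sin (u t r) ^ 2 / r ^ 2 := by
        field_simp
        ring
      rw [e2] at e
      linarith

lemma mem_coneRegion {S s r : ℝ} (h0 : 0 < s) (hS : s ≤ S) (hr : r ∈ Icc 0 s) :
    (2 * s - r, r) ∈ coneRegion S := by
  obtain ⟨h1, h2⟩ := hr
  refine ⟨?_, h1, ?_, ?_⟩ <;> simp only <;> linarith

lemma intervalIntegrable_cone {g : ℝ × ℝ → ℝ} {S s : ℝ} (hg : ContinuousOn g (coneRegion S))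
    (h0 : 0 < s) (hS : s ≤ S) :
    IntervalIntegrable (fun r => g (2 * s - r, r)) volume 0 s := by
  refine ContinuousOn.intervalIntegrable ?_
  rw [uIcc_of_le h0.le]
  exact hg.comp (f := fun r : ℝ => (2 * s - r, r)) (by fun_prop)
    fun r hr => mem_coneRegion h0 hS hr

lemma intervalIntegrable_diag {g : ℝ × ℝ → ℝ} {S a b : ℝ} (hg : ContinuousOn g (coneRegion S))
    (h0 : 0 < a) (hab : a ≤ b) (hS : b ≤ S) :
    IntervalIntegrable (fun s => g (s, s)) volume a b := by
  refine ContinuousOn.intervalIntegrable ?_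
  rw [uIcc_of_le hab]
  refine hg.comp (f := fun r : ℝ => (r, r)) (by fun_prop) fun r hr => ?_
  obtain ⟨h1, h2⟩ := hr
  refine ⟨?_, ?_, ?_, ?_⟩ <;> simp only <;> linarith

/-- Comparison of cone integrals up to an affine change of the majorant. -/
lemma coneInt_le_affine {f g : ℝ × ℝ → ℝ} {S s c d : ℝ} (hf : ContinuousOn f (coneRegion S))
    (hg : ContinuousOn g (coneRegion S)) (h0 : 0 < s) (hS : s ≤ S)
    (h : ∀ r ∈ Icc 0 s, f (2 * s - r, r) ≤ c * g (2 * s - r, r) + d) :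
    coneInt f s ≤ c * coneInt g s + d * s := by
  have ig := intervalIntegrable_cone hg h0 hS
  have e : (∫ r in (0 : ℝ)..s, (c * g (2 * s - r, r) + d)) = c * coneInt g s + d * s := by
    rw [intervalIntegral.integral_add (ig.const_mul c) intervalIntegrable_const,
      intervalIntegral.integral_const_mul, intervalIntegral.integral_const]
    simp only [coneInt, smul_eq_mul]
    ring
  rw [← e]
  exact intervalIntegral.integral_mono_on h0.le (intervalIntegrable_cone hf h0 hS)
    ((ig.const_mul c).add intervalIntegrable_const) h

lemma integral_le_const_mul {f : ℝ → ℝ} {a b C : ℝ} (hab : a ≤ b) (hC : 0 ≤ C)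
    (h : ∀ x ∈ Icc a b, f x ≤ C) : ∫ x in a..b, f x ≤ C * (b - a) := by
  by_cases hi : IntervalIntegrable f volume a b
  · have := intervalIntegral.integral_mono_on hab hi intervalIntegrable_const h
    rw [intervalIntegral.integral_const, smul_eq_mul] at this
    linarith
  · rw [intervalIntegral.integral_undef hi]
    exact mul_nonneg hC (sub_nonneg.2 hab)

section Multipliers

variable (U P Q K : ℝ × ℝ → ℝ)

/-- The density `r² e`. -/
noncomputable def energyDensity (z : ℝ × ℝ) : ℝ :=
  z.2 ^ 2 * ((P z ^ 2 + Q z ^ 2) / 2) + Real.sin (U z) ^ 2 + z.2 ^ 2 * K z ^ 2 / 2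

/-- The flux `r² u_t u_r`. -/
noncomputable def energyFlux (z : ℝ × ℝ) : ℝ := z.2 ^ 2 * (P z * Q z)

/-- The density associated with the multiplier `t u_t + r u_r + u`. -/
noncomputable def scalingDensity (z : ℝ × ℝ) : ℝ :=
  z.1 * (z.2 ^ 2 * ((P z ^ 2 + Q z ^ 2) / 2) + Real.sin (U z) ^ 2 + z.2 ^ 2 * K z ^ 2 / 2) +
    z.2 ^ 3 * (P z * Q z) + z.2 ^ 2 * (U z * P z)

/-- The flux associated with the multiplier `t u_t + r u_r + u`. -/
noncomputable def scalingFlux (z : ℝ × ℝ) : ℝ :=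
  z.2 ^ 2 * (z.1 * (P z * Q z) + U z * Q z) + z.2 ^ 3 * ((P z ^ 2 + Q z ^ 2) / 2) -
    z.2 * Real.sin (U z) ^ 2 - z.2 ^ 3 * K z ^ 2 / 2

/-- The bulk term associated with the multiplier `t u_t + r u_r + u`. -/
noncomputable def scalingBulk (z : ℝ × ℝ) : ℝ :=
  2 * Real.sin (U z) ^ 2 - U z * Real.sin (2 * U z) - 2 * (U z * K z) * Real.sin (U z) ^ 2

/-- The density of the degenerate energy on backward cones, times `r²`. -/
noncomputable def degenerateDensity (z : ℝ × ℝ) : ℝ :=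
  (1 - z.2 / z.1) * (z.2 ^ 2 * (P z - Q z) ^ 2) + z.2 ^ 2 * K z ^ 2

/-- Energy along backward cones. -/
noncomputable def coneEnergy (s : ℝ) : ℝ :=
  coneInt (fun z => energyDensity U P Q K z - energyFlux P Q z) s

/-- Scaling energy along backward cones. -/
noncomputable def coneScaling (s : ℝ) : ℝ :=
  coneInt (fun z => scalingDensity U P Q K z - scalingFlux U P Q K z) s

end Multipliers

namespace ConeSolution

variable {S : ℝ} {U P Q K : ℝ × ℝ → ℝ}

lemma continuousOn_energyDensity (h : ConeSolution S U P Q K) :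
    ContinuousOn (energyDensity U P Q K) (coneRegion S) := by
  have := h.contU; have := h.contP; have := h.contQ; have := h.contK
  unfold energyDensity
  fun_prop

lemma continuousOn_energyFlux (h : ConeSolution S U P Q K) :
    ContinuousOn (energyFlux P Q) (coneRegion S) := by
  have := h.contP; have := h.contQ
  unfold energyFlux
  fun_prop

lemma continuousOn_scalingDensity (h : ConeSolution S U P Q K) :
    ContinuousOn (scalingDensity U P Q K) (coneRegion S) := by
  have := h.contU; have := h.contP; have := h.contQ; have := h.contK
  unfold scalingDensity
  fun_prop

lemma continuousOn_scalingFlux (h : ConeSolution S U P Q K) :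
    ContinuousOn (scalingFlux U P Q K) (coneRegion S) := by
  have := h.contU; have := h.contP; have := h.contQ; have := h.contK
  unfold scalingFlux
  fun_prop

lemma continuousOn_scalingBulk (h : ConeSolution S U P Q K) :
    ContinuousOn (scalingBulk U K) (coneRegion S) := by
  have := h.contU; have := h.contK
  unfold scalingBulk
  fun_prop

lemma energy_identity (h : ConeSolution S U P Q K) {s₀ s₁ : ℝ} (h0 : 0 < s₀) (h01 : s₀ ≤ s₁)
    (h1 : s₁ ≤ S) :
    coneEnergy U P Q K s₁ - coneEnergy U P Q K s₀ =
      ∫ s in s₀..s₁, (energyDensity U P Q K (s, s) + energyFlux P Q (s, s)) := by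
  have key := coneInt_sub_coneInt (b := fun _ => 0) h.continuousOn_energyDensity
    h.continuousOn_energyFlux continuousOn_const
    (fun z hz hr => by
      have := h.diffU z hz hr; have := h.diffP z hz hr
      have := h.diffQ z hz hr; have := h.diffK z hz hr
      unfold energyDensity
      fun_prop)
    (fun z hz hr => by
      have := h.diffP z hz hr; have := h.diffQ z hz hr
      unfold energyFlux
      fun_prop)
    (by
      rintro ⟨t, r⟩ hz hr
      simp only at hr
      obtain ⟨p, m, q, Ut, Ur, Pt, Pr, Qt, Qr, Kt, Kr, he⟩ := h.eqn t r hz hr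
      refine ⟨_, _, ((((Pt.pow 2).add (Qt.pow 2)).div_const 2).const_mul (r ^ 2) |>.add
        (Ut.sin.pow 2)).add (((Kt.pow 2).const_mul (r ^ 2)).div_const 2),
        (hasDerivAt_pow 2 r).mul (Pr.mul Qr), ?_⟩
      simp only [he]
      field_simp
      push_cast
      ring)
    (fun t => by simp [energyFlux]) h0 h01 h1
  unfold coneEnergy
  rw [key]
  simp [coneInt]

lemma scaling_identity (h : ConeSolution S U P Q K) {s₀ s₁ : ℝ} (h0 : 0 < s₀) (h01 : s₀ ≤ s₁)
    (h1 : s₁ ≤ S) :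
    coneScaling U P Q K s₁ - coneScaling U P Q K s₀ =
      (∫ s in s₀..s₁, (scalingDensity U P Q K (s, s) + scalingFlux U P Q K (s, s))) +
        ∫ s in s₀..s₁, 2 * coneInt (scalingBulk U K) s := by
  refine coneInt_sub_coneInt h.continuousOn_scalingDensity
    h.continuousOn_scalingFlux h.continuousOn_scalingBulk
    (fun z hz hr => ?_) (fun z hz hr => ?_) ?_ (fun t => by simp [scalingFlux]) h0 h01 h1
  · have := h.diffU z hz hr; have := h.diffP z hz hr
    have := h.diffQ z hz hr; have := h.diffK z hz hr
    unfold scalingDensity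
    fun_prop
  · have := h.diffU z hz hr; have := h.diffP z hz hr
    have := h.diffQ z hz hr; have := h.diffK z hz hr
    unfold scalingFlux
    fun_prop
  · rintro ⟨t, r⟩ hz hr
    simp only at hr
    obtain ⟨p, m, q, Ut, Ur, Pt, Pr, Qt, Qr, Kt, Kr, he⟩ := h.eqn t r hz hr
    have hK : skyrme (U (t, r)) = r ^ 2 * K (t, r) := (h.quot _ hz).symm
    refine ⟨_, _, (((hasDerivAt_id' t).mul
      (((((Pt.pow 2).add (Qt.pow 2)).div_const 2).const_mul (r ^ 2) |>.add
        (Ut.sin.pow 2)).add (((Kt.pow 2).const_mul (r ^ 2)).div_const 2))).add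
        ((Pt.mul Qt).const_mul (r ^ 3))).add ((Ut.mul Pt).const_mul (r ^ 2)),
      ((((hasDerivAt_pow 2 r).mul (((Pr.mul Qr).const_mul t).add (Ur.mul Qr))).add
        ((hasDerivAt_pow 3 r).mul (((Pr.pow 2).add (Qr.pow 2)).div_const 2))).sub
        ((hasDerivAt_id' r).mul (Ur.sin.pow 2))).sub
        (((hasDerivAt_pow 3 r).mul (Kr.pow 2)).div_const 2), ?_⟩
    simp only [he, scalingBulk, Real.sin_two_mul, Pi.mul_apply, Pi.add_apply, Pi.pow_apply]
    field_simp
    push_cast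
    ring

lemma sq_le (h : ConeSolution S U P Q K) {z : ℝ × ℝ} (hz : z ∈ coneRegion S) :
    U z ^ 2 ≤ 2 * (z.2 ^ 4 * K z ^ 2) + 1 / 2 := by
  have := sq_le_skyrme_sq (U z)
  rw [← h.quot z hz] at this
  linarith

lemma coneEnergy_nonneg {s : ℝ} (h0 : 0 ≤ s) : 0 ≤ coneEnergy U P Q K s := by
  refine intervalIntegral.integral_nonneg h0 fun r _ => ?_
  simp only [energyDensity, energyFlux]
  set z := (2 * s - r, r)
  have : 0 ≤ r ^ 2 * (P z - Q z) ^ 2 / 2 + Real.sin (U z) ^ 2 + r ^ 2 * K z ^ 2 / 2 := by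
    positivity
  linarith

lemma coneEnergy_mono (h : ConeSolution S U P Q K) {s₀ s₁ : ℝ} (h0 : 0 < s₀) (h01 : s₀ ≤ s₁)
    (h1 : s₁ ≤ S) : coneEnergy U P Q K s₀ ≤ coneEnergy U P Q K s₁ := by
  have key := h.energy_identity h0 h01 h1
  have : 0 ≤ ∫ s in s₀..s₁, (energyDensity U P Q K (s, s) + energyFlux P Q (s, s)) := by
    refine intervalIntegral.integral_nonneg h01 fun s _ => ?_
    simp only [energyDensity, energyFlux]
    have : 0 ≤ s ^ 2 * (P (s, s) + Q (s, s)) ^ 2 / 2 + Real.sin (U (s, s)) ^ 2 +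
        s ^ 2 * K (s, s) ^ 2 / 2 := by positivity
    linarith
  linarith

lemma diag_integral_le (h : ConeSolution S U P Q K) {s₀ s₁ : ℝ} (h0 : 0 < s₀) (h01 : s₀ ≤ s₁)
    (h1 : s₁ ≤ S) (hs : s₁ ≤ 1) :
    (∫ s in s₀..s₁, (scalingDensity U P Q K (s, s) + scalingFlux U P Q K (s, s))) ≤
      5 * s₁ * (coneEnergy U P Q K s₁ - coneEnergy U P Q K s₀) + s₁ ^ 2 / 4 := by
  rw [h.energy_identity h0 h01 h1]
  have iE : IntervalIntegrable (fun s => energyDensity U P Q K (s, s) + energyFlux P Q (s, s))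
      volume s₀ s₁ := intervalIntegrable_diag
    (h.continuousOn_energyDensity.add h.continuousOn_energyFlux) h0 h01 h1
  have iS : IntervalIntegrable
      (fun s => scalingDensity U P Q K (s, s) + scalingFlux U P Q K (s, s)) volume s₀ s₁ :=
    intervalIntegrable_diag
    (h.continuousOn_scalingDensity.add h.continuousOn_scalingFlux) h0 h01 h1
  calc _ ≤ ∫ s in s₀..s₁, (5 * s₁ * (energyDensity U P Q K (s, s) + energyFlux P Q (s, s)) +
        s₁ / 4) := by
        refine intervalIntegral.integral_mono_on h01 iS
          ((iE.const_mul (5 * s₁)).add intervalIntegrable_const) fun s hs' => ?_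
        have hpos : 0 < s := h0.trans_le hs'.1
        have hm : (s, s) ∈ coneRegion S := by
          refine ⟨hpos, hpos.le, le_rfl, ?_⟩
          simp only
          linarith [hs'.2]
        have hU := h.sq_le hm
        simp only at hU
        set a := P (s, s) + Q (s, s) with ha
        set k := K (s, s)
        set w := Real.sin (U (s, s)) ^ 2
        have hw : 0 ≤ w := sq_nonneg _
        have e1 : energyDensity U P Q K (s, s) + energyFlux P Q (s, s) =
            s ^ 2 * a ^ 2 / 2 + w + s ^ 2 * k ^ 2 / 2 := by
          simp only [energyDensity, energyFlux, ha]
          ring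
        have e2 : scalingDensity U P Q K (s, s) + scalingFlux U P Q K (s, s) =
            s ^ 3 * a ^ 2 + s ^ 2 * (U (s, s) * a) := by
          simp only [scalingDensity, scalingFlux, ha]
          ring
        rw [e1, e2]
        have b1 : s ^ 2 * (U (s, s) * a) ≤ (s ^ 3 * a ^ 2 + s * U (s, s) ^ 2) / 2 := by
          nlinarith [mul_nonneg hpos.le (sq_nonneg (s * a - U (s, s)))]
        have b2 : s * U (s, s) ^ 2 ≤ s * (2 * (s ^ 4 * k ^ 2) + 1 / 2) := by gcongr
        have hs2 : s ^ 2 ≤ 1 := by nlinarith [hs'.2]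
        have b3 : s * (s ^ 2 * k ^ 2) * s ^ 2 ≤ s * (s ^ 2 * k ^ 2) :=
          mul_le_of_le_one_right (by positivity) hs2
        have hE : 0 ≤ s ^ 2 * a ^ 2 / 2 + w + s ^ 2 * k ^ 2 / 2 := by positivity
        have b4 : s * (s ^ 2 * a ^ 2 / 2 + w + s ^ 2 * k ^ 2 / 2) ≤
            s₁ * (s ^ 2 * a ^ 2 / 2 + w + s ^ 2 * k ^ 2 / 2) := by gcongr; exact hs'.2
        have b5 : 0 ≤ s * w := by positivity
        have b6 : 0 ≤ s * (s ^ 2 * a ^ 2) := by positivity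
        have b7 : 0 ≤ s * (s ^ 2 * k ^ 2) := by positivity
        have b8 := hs'.2
        linarith
    _ = 5 * s₁ * (∫ s in s₀..s₁, (energyDensity U P Q K (s, s) + energyFlux P Q (s, s))) +
        s₁ / 4 * (s₁ - s₀) := by
        rw [intervalIntegral.integral_add (iE.const_mul _) intervalIntegrable_const,
          intervalIntegral.integral_const_mul, intervalIntegral.integral_const, smul_eq_mul]
        ring
    _ ≤ _ := by nlinarith [mul_pos h0 (h0.trans_le h01)]

lemma bulk_integral_le (h : ConeSolution S U P Q K) {s₀ s₁ M : ℝ} (h0 : 0 < s₀) (h01 : s₀ ≤ s₁)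
    (h1 : s₁ ≤ S) (hs : s₁ ≤ 1) (hM : coneEnergy U P Q K s₁ ≤ M) :
    (∫ s in s₀..s₁, 2 * coneInt (scalingBulk U K) s) ≤ s₁ ^ 2 * (32 * M + 4) := by
  have hM0 : 0 ≤ M := (coneEnergy_nonneg (h0.le.trans h01)).trans hM
  have hs1 : 0 < s₁ := h0.trans_le h01
  have key := integral_le_const_mul (f := fun s => 2 * coneInt (scalingBulk U K) s)
    (C := s₁ * (32 * M + 4)) h01 (by positivity) fun s hs' => by
      have hpos : 0 < s := h0.trans_le hs'.1
      have hsS : s ≤ S := hs'.2.trans h1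
      have b := coneInt_le_affine (c := 16 * s₁) (d := 2) h.continuousOn_scalingBulk
        (h.continuousOn_energyDensity.sub h.continuousOn_energyFlux) hpos hsS fun r hr => by
          have hU := h.sq_le (mem_coneRegion hpos hsS hr)
          have hUK := h.mul_quot_nonneg (2 * s - r, r)
          simp only [Pi.sub_apply, energyDensity, energyFlux, scalingBulk]
          simp only at hU
          set z := (2 * s - r, r)
          have c1 := (abs_le.1 (mul_sin_two_le (U z))).1
          have c2 : Real.sin (U z) ^ 2 ≤ U z ^ 2 := sq_le_sq.2 Real.abs_sin_le_abs
          have c3 : 0 ≤ U z * K z * Real.sin (U z) ^ 2 := by positivity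
          have hr2 : r ^ 2 ≤ s₁ := by nlinarith [hr.1, hr.2, hs'.2]
          have c4 : r ^ 2 * (r ^ 2 * K z ^ 2) ≤ s₁ * (r ^ 2 * K z ^ 2) := by gcongr
          have c5 : 0 ≤ s₁ * (r ^ 2 * (P z - Q z) ^ 2 / 2 + Real.sin (U z) ^ 2) := by positivity
          nlinarith
      have hmono : coneInt (energyDensity U P Q K - energyFlux P Q) s ≤ M :=
        (h.coneEnergy_mono hpos hs'.2 h1).trans hM
      have c1 : 16 * s₁ * coneInt (energyDensity U P Q K - energyFlux P Q) s ≤ 16 * s₁ * M := by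
        gcongr
      have := hs'.2
      linarith
  refine key.trans ?_
  have : 0 ≤ s₁ * (32 * M + 4) := by positivity
  nlinarith [mul_nonneg this h0.le]

/-- Pointwise bound for the lower-order term of the scaling energy. -/
lemma cross_term_le {r a v k σ : ℝ} (hσ : 0 < σ) (hσ1 : σ ≤ 1) (hr0 : 0 ≤ r) (hr : r ≤ σ ^ 2)
    (hv : v ^ 2 ≤ 2 * (r ^ 4 * k ^ 2) + 1 / 2) :
    |r ^ 2 * (v * a)| ≤ 3 * σ ^ 3 * (r ^ 2 * a ^ 2 / 2 + r ^ 2 * k ^ 2 / 2) + σ / 4 := by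
  have hr2 : r ^ 2 ≤ σ ^ 4 := by
    calc r ^ 2 ≤ (σ ^ 2) ^ 2 := by gcongr
      _ = σ ^ 4 := by ring
  have b1 : r ^ 2 * v ^ 2 ≤ σ ^ 4 * (2 * (σ ^ 2 * (r ^ 2 * k ^ 2)) + 1 / 2) := by
    have e1 : r ^ 2 * (r ^ 2 * k ^ 2) ≤ σ ^ 2 * (r ^ 2 * k ^ 2) :=
      mul_le_mul_of_nonneg_right
        (hr2.trans (pow_le_pow_of_le_one hσ.le hσ1 (by norm_num : 2 ≤ 4))) (by positivity)
    calc r ^ 2 * v ^ 2 ≤ σ ^ 4 * v ^ 2 := by gcongr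
      _ ≤ σ ^ 4 * (2 * (σ ^ 2 * (r ^ 2 * k ^ 2)) + 1 / 2) := by
        gcongr
        linarith
  set X := 2 * (σ ^ 2 * (r ^ 2 * k ^ 2)) + 1 / 2 with hX
  have hp : 0 < σ ^ 3 := by positivity
  have b2 : |r ^ 2 * (v * a)| * (2 * σ ^ 3) ≤ (σ ^ 3 * (r * a) ^ 2 + σ * X) * σ ^ 3 := by
    have e : |r ^ 2 * (v * a)| = |r * v| * |r * a| := by
      rw [← abs_mul]; congr 1; ring
    have q := sq_nonneg (σ ^ 3 * |r * a| - |r * v|)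
    have e1 : |r * a| ^ 2 = (r * a) ^ 2 := sq_abs _
    have e2 : |r * v| ^ 2 = r ^ 2 * v ^ 2 := by rw [sq_abs]; ring
    have e3 : |r * v| * |r * a| * (2 * σ ^ 3) =
        σ ^ 6 * |r * a| ^ 2 + |r * v| ^ 2 - (σ ^ 3 * |r * a| - |r * v|) ^ 2 := by ring
    rw [e, e3, e1, e2]
    linarith
  have b3 : |r ^ 2 * (v * a)| * 2 ≤ σ ^ 3 * (r * a) ^ 2 + σ * X := by
    nlinarith
  have b4 : 0 ≤ σ ^ 3 * (r ^ 2 * a ^ 2) := by positivity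
  have b5 : 0 ≤ σ ^ 3 * (r ^ 2 * k ^ 2) := by positivity
  rw [hX] at b3
  linarith

lemma continuousOn_degenerateDensity (h : ConeSolution S U P Q K) :
    ContinuousOn (degenerateDensity P Q K) (coneRegion S) := by
  have := h.contP; have := h.contQ; have := h.contK
  have hq : ContinuousOn (fun z : ℝ × ℝ => z.2 / z.1) (coneRegion S) :=
    continuousOn_snd.div continuousOn_fst fun z hz => hz.1.ne'
  unfold degenerateDensity
  fun_prop

lemma coneInt_degenerateDensity_nonneg {s : ℝ} (h0 : 0 < s) :
    0 ≤ coneInt (degenerateDensity P Q K) s := by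
  refine intervalIntegral.integral_nonneg h0.le fun r hr => ?_
  simp only [degenerateDensity]
  have : r / (2 * s - r) ≤ 1 := by
    rw [div_le_one (by linarith [hr.2])]
    linarith [hr.2]
  have h2 := sub_nonneg.2 this
  positivity

lemma degenerate_le_coneScaling (h : ConeSolution S U P Q K) {σ M : ℝ} (hσ : 0 < σ) (hσ1 : σ ≤ 1)
    (hS : σ ^ 2 ≤ S) (hM : coneEnergy U P Q K (σ ^ 2) ≤ M) :
    σ ^ 2 / 2 * coneInt (degenerateDensity P Q K) (σ ^ 2) ≤
      coneScaling U P Q K (σ ^ 2) + σ ^ 3 * (3 * M + 1) := by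
  have hpos : 0 < σ ^ 2 := by positivity
  have b := coneInt_le_affine (s := σ ^ 2) (c := 3 * σ ^ 3) (d := σ / 4)
    (f := fun z => σ ^ 2 / 2 * degenerateDensity P Q K z -
      (scalingDensity U P Q K z - scalingFlux U P Q K z))
    ((continuousOn_const.mul h.continuousOn_degenerateDensity).sub
      (h.continuousOn_scalingDensity.sub h.continuousOn_scalingFlux))
    (h.continuousOn_energyDensity.sub h.continuousOn_energyFlux) hpos hS fun r hr => by
      have hU := h.sq_le (mem_coneRegion hpos hS hr)
      simp only [Pi.sub_apply, energyDensity, energyFlux, scalingDensity, scalingFlux,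
        degenerateDensity]
      simp only at hU
      obtain ⟨hr0, hrs⟩ := hr
      set z := (2 * σ ^ 2 - r, r)
      have c1 := (abs_le.1 (cross_term_le (a := P z - Q z) hσ hσ1 hr0 hrs hU)).1
      have ht : 0 < 2 * σ ^ 2 - r := by linarith
      have c2 : σ ^ 2 * (1 - r / (2 * σ ^ 2 - r)) ≤ 2 * σ ^ 2 - r - r := by
        have e1 : (1 - r / (2 * σ ^ 2 - r)) = (2 * σ ^ 2 - r - r) / (2 * σ ^ 2 - r) := by
          field_simp
        rw [e1, ← mul_div_assoc, div_le_iff₀ ht]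
        nlinarith
      have c3 := mul_le_mul_of_nonneg_right c2
        (by positivity : 0 ≤ r ^ 2 * (P z - Q z) ^ 2 / 2)
      have c4 : 0 ≤ σ ^ 2 * Real.sin (U z) ^ 2 := by positivity
      have c5 : 0 ≤ σ ^ 3 * Real.sin (U z) ^ 2 := by positivity
      have c6 : 0 ≤ σ ^ 2 * (r ^ 2 * K z ^ 2) := by positivity
      linarith
  have e : coneInt (fun z => σ ^ 2 / 2 * degenerateDensity P Q K z -
      (scalingDensity U P Q K z - scalingFlux U P Q K z)) (σ ^ 2) =
      σ ^ 2 / 2 * coneInt (degenerateDensity P Q K) (σ ^ 2) - coneScaling U P Q K (σ ^ 2) := by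
    have i1 := intervalIntegrable_cone h.continuousOn_degenerateDensity hpos hS
    have i2 : IntervalIntegrable (fun r => scalingDensity U P Q K (2 * σ ^ 2 - r, r) -
        scalingFlux U P Q K (2 * σ ^ 2 - r, r)) volume 0 (σ ^ 2) := intervalIntegrable_cone
      (h.continuousOn_scalingDensity.sub h.continuousOn_scalingFlux) hpos hS
    unfold coneInt coneScaling coneInt
    beta_reduce
    rw [intervalIntegral.integral_sub (i1.const_mul _) i2, intervalIntegral.integral_const_mul]
  rw [e] at b
  have c : 3 * σ ^ 3 * coneInt (energyDensity U P Q K - energyFlux P Q) (σ ^ 2) ≤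
      3 * σ ^ 3 * M := mul_le_mul_of_nonneg_left hM (by positivity)
  have : 0 ≤ σ ^ 3 := by positivity
  linarith

lemma coneScaling_le (h : ConeSolution S U P Q K) {σ M : ℝ} (hσ : 0 < σ) (hσ1 : σ ≤ 1)
    (hS : σ ^ 2 ≤ S) (hM : coneEnergy U P Q K (σ ^ 2) ≤ M) :
    coneScaling U P Q K (σ ^ 2) ≤ σ ^ 2 * (5 * M + 1) := by
  have hpos : 0 < σ ^ 2 := by positivity
  have b := coneInt_le_affine (s := σ ^ 2) (c := 5 * σ ^ 2) (d := σ / 4)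
    (h.continuousOn_scalingDensity.sub h.continuousOn_scalingFlux)
    (h.continuousOn_energyDensity.sub h.continuousOn_energyFlux) hpos hS fun r hr => by
      have hU := h.sq_le (mem_coneRegion hpos hS hr)
      simp only [Pi.sub_apply, energyDensity, energyFlux, scalingDensity, scalingFlux]
      simp only at hU
      obtain ⟨hr0, hrs⟩ := hr
      set z := (2 * σ ^ 2 - r, r)
      have c1 := (abs_le.1 (cross_term_le (a := P z - Q z) hσ hσ1 hr0 hrs hU)).2
      have c2 : 0 ≤ r * (r ^ 2 * (P z - Q z) ^ 2) := by positivity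
      have c3 : σ ^ 3 * (r ^ 2 * (P z - Q z) ^ 2 / 2 + r ^ 2 * K z ^ 2 / 2) ≤
          σ ^ 2 * (r ^ 2 * (P z - Q z) ^ 2 / 2 + r ^ 2 * K z ^ 2 / 2) :=
        mul_le_mul_of_nonneg_right
          (pow_le_pow_of_le_one hσ.le hσ1 (by norm_num : 2 ≤ 3)) (by positivity)
      have c4 : 0 ≤ σ ^ 2 * Real.sin (U z) ^ 2 := by positivity
      have c5 : 0 ≤ σ ^ 2 * (r ^ 2 * (P z - Q z) ^ 2) := by positivity
      linarith
  have c : 5 * σ ^ 2 * coneInt (energyDensity U P Q K - energyFlux P Q) (σ ^ 2) ≤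
      5 * σ ^ 2 * M := mul_le_mul_of_nonneg_left hM (by positivity)
  have e : coneScaling U P Q K (σ ^ 2) =
    coneInt (scalingDensity U P Q K - scalingFlux U P Q K) (σ ^ 2) := rfl
  rw [e]
  nlinarith

/-- Decay of the degenerate energy along the cones at times `σₙ²`. -/
lemma tendsto_coneInt_degenerateDensity (h : ConeSolution S U P Q K) {σ : ℕ → ℝ}
    (hσ : ∀ n, 0 < σ n) (hσ1 : ∀ n, σ n ≤ 1) (hS : ∀ n, σ n ^ 2 ≤ S) (hanti : Antitone σ)
    (hlim : Tendsto σ atTop (𝓝 0)) :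
    Tendsto (fun n => coneInt (degenerateDensity P Q K) (σ n ^ 2)) atTop (𝓝 0) := by
  set E : ℕ → ℝ := fun n => coneEnergy U P Q K (σ n ^ 2) with hE
  have hsq : ∀ {m n}, n ≤ m → σ m ^ 2 ≤ σ n ^ 2 := fun {m n} hmn =>
    pow_le_pow_left₀ (hσ m).le (hanti hmn) 2
  have hEanti : Antitone E := fun n m hmn =>
    h.coneEnergy_mono (pow_pos (hσ m) 2) (hsq hmn) (hS n)
  have hE0 : ∀ n, 0 ≤ E n := fun n => coneEnergy_nonneg (sq_nonneg _)
  have hElim := tendsto_atTop_ciInf hEanti ⟨0, by rintro _ ⟨n, rfl⟩; exact hE0 n⟩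
  set L := ⨅ n, E n
  have hL : ∀ n, L ≤ E n := fun n => ciInf_le ⟨0, by rintro _ ⟨n, rfl⟩; exact hE0 n⟩ n
  set M := E 0 with hMdef
  have hM : ∀ n, E n ≤ M := fun n => hEanti (Nat.zero_le n)
  have bound : ∀ n, coneInt (degenerateDensity P Q K) (σ n ^ 2) ≤
      2 * (5 * (E n - L) + σ n ^ 2 * (32 * M + 5) + σ n * (3 * M + 1)) := by
    intro n
    have hn := hσ n
    have step : ∀ m, n ≤ m → σ n ^ 2 / 2 * coneInt (degenerateDensity P Q K) (σ n ^ 2) ≤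
        σ m ^ 2 * (5 * M + 1) + (5 * σ n ^ 2 * (E n - L) + σ n ^ 4 * (32 * M + 5) +
          σ n ^ 3 * (3 * M + 1)) := by
      intro m hnm
      have a1 := h.degenerate_le_coneScaling hn (hσ1 n) (hS n) (hM n)
      have a2 := h.coneScaling_le (hσ m) (hσ1 m) (hS m) (hM m)
      have hm0 := pow_pos (hσ m) 2
      have hle1 : σ n ^ 2 ≤ 1 := pow_le_one₀ hn.le (hσ1 n)
      have a3 := h.scaling_identity hm0 (hsq hnm) (hS n)
      have a4 := h.diag_integral_le hm0 (hsq hnm) (hS n) hle1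
      have a5 := h.bulk_integral_le hm0 (hsq hnm) (hS n) hle1 (hM n)
      have a6 : 5 * σ n ^ 2 * (E n - E m) ≤ 5 * σ n ^ 2 * (E n - L) := by
        gcongr
        exact hL m
      have a7 : 0 ≤ (σ n ^ 2) ^ 2 := by positivity
      linarith
    have hm : Tendsto (fun m => σ m ^ 2 * (5 * M + 1) + (5 * σ n ^ 2 * (E n - L) +
        σ n ^ 4 * (32 * M + 5) + σ n ^ 3 * (3 * M + 1))) atTop
        (𝓝 (0 ^ 2 * (5 * M + 1) + (5 * σ n ^ 2 * (E n - L) +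
        σ n ^ 4 * (32 * M + 5) + σ n ^ 3 * (3 * M + 1)))) :=
      ((hlim.pow 2).mul_const _).add_const _
    have fin := ge_of_tendsto hm ((eventually_ge_atTop n).mono step)
    refine le_of_mul_le_mul_left ?_ (by positivity : 0 < σ n ^ 2 / 2)
    refine fin.trans (le_of_eq ?_)
    ring
  refine squeeze_zero (fun n => coneInt_degenerateDensity_nonneg (pow_pos (hσ n) 2)) bound ?_
  have := ((((hElim.sub_const L).const_mul 5).add ((hlim.pow 2).mul_const (32 * M + 5))).add
    (hlim.mul_const (3 * M + 1))).const_mul 2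
  simpa using this

end ConeSolution

/-- Existence of a sequence of backward light cones along which the degenerate energy
decays: there are `sₙ → 0⁺` with
`∫_0^{sₙ} [(1 - r/(2sₙ - r)) u₋(2sₙ - r, r)² + (u - sin u cos u)²/r⁴] r² dr → 0`. -/
theorem cone_energy_decay_along_sequence (u : ℝ → ℝ → ℝ) (Tbar : ℝ)
    (h : BackwardFramework u Tbar) :
    ∃ s : ℕ → ℝ, (∀ n, 0 < s n) ∧ Tendsto s atTop (𝓝 0) ∧
      Tendsto (fun n =>
        ∫ r in (0 : ℝ)..(s n),
          ((1 - r / (2 * s n - r)) * uminus u (2 * s n - r) r ^ 2 +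
            (u (2 * s n - r) r -
              Real.sin (u (2 * s n - r) r) * Real.cos (u (2 * s n - r) r)) ^ 2 / r ^ 4) *
            r ^ 2) atTop (𝓝 0) := by
  have hT := h.1
  have hc := h.coneSolution
  set c := min (Tbar / 2) 1 with hcdef
  have hc0 : 0 < c := by positivity
  have hc1 : c ≤ 1 := min_le_right _ _
  have hcT : c ≤ Tbar / 2 := min_le_left _ _
  set σ : ℕ → ℝ := fun n => c * (1 / ((n : ℝ) + 1)) with hσdef
  have hσ : ∀ n, 0 < σ n := fun n => by positivity
  have hanti : Antitone σ := fun n m hnm =>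
    mul_le_mul_of_nonneg_left (one_div_le_one_div_of_le (by positivity) (by gcongr)) hc0.le
  have hσc : ∀ n, σ n ≤ c := fun n => by
    have := hanti (Nat.zero_le n)
    simpa [hσdef] using this
  have hσ1 : ∀ n, σ n ≤ 1 := fun n => (hσc n).trans hc1
  have hlim : Tendsto σ atTop (𝓝 0) := by
    have := (tendsto_one_div_add_atTop_nhds_zero_nat (𝕜 := ℝ)).const_mul c
    rwa [mul_zero] at this
  have hS : ∀ n, σ n ^ 2 ≤ Tbar / 2 := fun n =>
    (pow_le_of_le_one (hσ n).le (hσ1 n) two_ne_zero).trans ((hσc n).trans hcT)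
  refine ⟨fun n => σ n ^ 2, fun n => pow_pos (hσ n) 2, by simpa using hlim.pow 2, ?_⟩
  refine (hc.tendsto_coneInt_degenerateDensity hσ hσ1 hS hanti hlim).congr fun n => ?_
  unfold coneInt
  congr 1
  ext r
  simp only [degenerateDensity, skyrmeQuot, skyrme, uminus]
  rcases eq_or_ne r 0 with rfl | hr
  · simp
  · field_simp
end
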